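/- Let n ≥ 5, a ≥ 0 and p > (n+4+2a)/(n-4) with p·ℓ₁ > n(n-4)/2 and p·ℓ₂ > n²(n-4)²/16, and let u be a smooth stable solution of Δ²u = |x|^a |u|^{p-1} u on ℝ^n. Then lim_{r → +∞} E(r; 0, u) = 0. -/

import Mathlib

open MeasureTheory Metric Set Filter
open scoped RealInnerProductSpace Topology

noncomputable section

/-- The Laplacian of `u : ℝⁿ → ℝ` at `x`, as the sum of the pure second
partial derivatives in the coordinate directions. -/
def lap (n : ℕ) (u : EuclideanSpace ℝ (Fin n) → ℝ) (x : EuclideanSpace ℝ (Fin n)) : ℝ :=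
  ∑ i : Fin n, iteratedFDeriv ℝ 2 u x ![EuclideanSpace.single i 1, EuclideanSpace.single i 1]

/-- `u` solves `Δ²u = |x|^a |u|^(p-1) u` pointwise on `Ω`. -/
def IsSolutionOn (n : ℕ) (a p : ℝ) (u : EuclideanSpace ℝ (Fin n) → ℝ)
    (Ω : Set (EuclideanSpace ℝ (Fin n))) : Prop :=
  ∀ x ∈ Ω, lap n (lap n u) x = ‖x‖ ^ a * |u x| ^ (p - 1) * u x

/-- `u` is a stable solution on `Ω`:
`p ∫ |x|^a |u|^(p-1) ψ² ≤ ∫ (Δψ)²` for every test function `ψ ∈ C_c^∞(Ω)`. -/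
def StableOn (n : ℕ) (a p : ℝ) (u : EuclideanSpace ℝ (Fin n) → ℝ)
    (Ω : Set (EuclideanSpace ℝ (Fin n))) : Prop :=
  ∀ ψ : EuclideanSpace ℝ (Fin n) → ℝ, ContDiff ℝ (⊤ : ℕ∞) ψ → HasCompactSupport ψ →
    tsupport ψ ⊆ Ω →
    p * ∫ x, ‖x‖ ^ a * |u x| ^ (p - 1) * ψ x ^ 2 ≤ ∫ x, lap n ψ x ^ 2

/-- Surface integral of `f` over the sphere `∂B_r(x)`, with respect to the
`(n-1)`-dimensional Hausdorff measure. -/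
def sphInt (n : ℕ) (x : EuclideanSpace ℝ (Fin n)) (r : ℝ)
    (f : EuclideanSpace ℝ (Fin n) → ℝ) : ℝ :=
  ∫ y in sphere x r, f y ∂(Measure.hausdorffMeasure ((n : ℝ) - 1))

/-- Radial derivative of `u` at `y`, relative to the center `x`. -/
def radDeriv (n : ℕ) (x : EuclideanSpace ℝ (Fin n))
    (u : EuclideanSpace ℝ (Fin n) → ℝ) (y : EuclideanSpace ℝ (Fin n)) : ℝ :=
  ⟪gradient u y, ‖y - x‖⁻¹ • (y - x)⟫

/-- `ℓ₁ = (β+2)(n-4-β) + β(n-2-β)` with `β = (4+a)/(p-1)`. -/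
def ell1 (n : ℕ) (a p : ℝ) : ℝ :=
  let β : ℝ := (4 + a) / (p - 1)
  (β + 2) * ((n : ℝ) - 4 - β) + β * ((n : ℝ) - 2 - β)

/-- `ℓ₂ = β(β+2)(n-4-β)(n-2-β)` with `β = (4+a)/(p-1)`. -/
def ell2 (n : ℕ) (a p : ℝ) : ℝ :=
  let β : ℝ := (4 + a) / (p - 1)
  β * (β + 2) * ((n : ℝ) - 4 - β) * ((n : ℝ) - 2 - β)

/-- The constant `c(n,p,a) = 2(ρ - γ - 1)`, `ρ = n-1-2β`, `γ = β(β-n+2)`. -/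
def cConst (n : ℕ) (a p : ℝ) : ℝ :=
  let β : ℝ := (4 + a) / (p - 1)
  2 * (((n : ℝ) - 1 - 2 * β) - β * (β - (n : ℝ) + 2) - 1)

/-- The rescaled energy `E(r; x, u)` from the monotonicity formula. -/
def energyE (n : ℕ) (a p : ℝ) (u : EuclideanSpace ℝ (Fin n) → ℝ)
    (x : EuclideanSpace ℝ (Fin n)) (r : ℝ) : ℝ :=
  let β : ℝ := (4 + a) / (p - 1)
  r ^ (2 * β + 4 - (n : ℝ)) *
      (∫ y in ball x r,
        (1 / 2) * lap n u y ^ 2 - (1 / (p + 1)) * ‖y‖ ^ a * |u y| ^ (p + 1))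
    + β / 2 * ((n : ℝ) - 2 - β) *
        deriv (fun ρ : ℝ => ρ ^ (2 * β + 1 - (n : ℝ)) * sphInt n x ρ fun y => u y ^ 2) r
    + β / 2 * ((n : ℝ) - 2 - β) *
        deriv (fun ρ : ℝ => ρ ^ (2 * β + 2 - (n : ℝ)) * sphInt n x ρ fun y => u y ^ 2) r
    + r ^ 3 / 2 *
        deriv (fun ρ : ℝ => ρ ^ (2 * β + 1 - (n : ℝ)) *
          sphInt n x ρ fun y => (β * ρ⁻¹ * u y + radDeriv n x u y) ^ 2) r
    + 1 / 2 *
        deriv (fun ρ : ℝ => ρ ^ (2 * β + 4 - (n : ℝ)) *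
          sphInt n x ρ fun y => ‖gradient u y‖ ^ 2 - radDeriv n x u y ^ 2) r
    + 1 / 2 * r ^ (2 * β + 3 - (n : ℝ)) *
        (sphInt n x r fun y => ‖gradient u y‖ ^ 2 - radDeriv n x u y ^ 2)

end

namespace Cyl

section Identities

variable {R ι : Type*} [CommRing R] [Algebra ℝ R] [Fintype ι]

/-- The second-order operator `½ ∑ Xᵢ²` attached to a finite family of derivations. -/
noncomputable def Lam (X : ι → Derivation ℝ R R) (f : R) : R := (1 / 2 : ℝ) • ∑ i, X i (X i f)

/-- The carré du champ `½ ∑ Xᵢ f · Xᵢ g` attached to a finite family of derivations. -/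
noncomputable def Gam (X : ι → Derivation ℝ R R) (f g : R) : R :=
  (1 / 2 : ℝ) • ∑ i, X i f * X i g

/-- A radial derivation `E` and tangential derivations `X` commuting with it, together with a
linear functional `J` which kills derivatives of the elements of an ideal `I`. -/
structure Setting (E : Derivation ℝ R R) (X : ι → Derivation ℝ R R) (J : R →ₗ[ℝ] ℝ)
    (I : Ideal R) : Prop where
  comm : ∀ i f, E (X i f) = X i (E f)
  stable : ∀ f ∈ I, E f ∈ I
  stable' : ∀ i, ∀ f ∈ I, X i f ∈ I
  radial : ∀ f ∈ I, J (E f) = 0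
  tangential : ∀ i, ∀ f ∈ I, J (X i f) = 0

variable {E : Derivation ℝ R R} {X : ι → Derivation ℝ R R} {J : R →ₗ[ℝ] ℝ} {I : Ideal R}

lemma Lam_add (f g : R) : Lam X (f + g) = Lam X f + Lam X g := by
  simp [Lam, Finset.sum_add_distrib]

lemma Lam_smul (c : ℝ) (f : R) : Lam X (c • f) = c • Lam X f := by
  simp only [Lam, Derivation.map_smul, ← Finset.smul_sum, smul_comm c]

lemma Lam_mul {q : R} (hq : ∀ i, X i q = 0) (f : R) : Lam X (q * f) = q * Lam X f := by
  simp [Lam, hq, Finset.mul_sum]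

lemma Gam_mul {q : R} (hq : ∀ i, X i q = 0) (f g : R) : Gam X (q * f) g = q * Gam X f g := by
  simp [Gam, hq, Finset.mul_sum, mul_assoc]

lemma Gam_comm (f g : R) : Gam X f g = Gam X g f := by
  simp [Gam, mul_comm]

lemma Gam_add (f g h : R) : Gam X (f + g) h = Gam X f h + Gam X g h := by
  simp [Gam, add_mul, Finset.sum_add_distrib]

lemma Setting.radial_Lam (S : Setting E X J I) (f : R) : E (Lam X f) = Lam X (E f) := by
  simp [Lam, S.comm, map_sum]

lemma Setting.radial_Gam (S : Setting E X J I) (f g : R) :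
    E (Gam X f g) = Gam X (E f) g + Gam X f (E g) := by
  simp only [Gam, Derivation.map_smul, map_sum, Derivation.leibniz, S.comm, smul_eq_mul,
    Finset.sum_add_distrib, smul_add]
  rw [add_comm]
  congr 2
  exact Finset.sum_congr rfl fun i _ => mul_comm _ _

omit [Fintype ι] in
lemma Setting.tangential_radial (S : Setting E X J I) {q : R} (hq : ∀ i, X i q = 0) (i : ι) :
    X i (E q) = 0 := by
  rw [← S.comm, hq, map_zero]

lemma Setting.J_mul_Lam (S : Setting E X J I) {q : R} (hq : ∀ i, X i q = 0) (hI : q ∈ I)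
    (f g : R) : J (q * f * Lam X g) = -J (q * Gam X f g) := by
  have h : ∀ i, J (q * f * X i (X i g)) = -J (q * (X i f * X i g)) := by
    intro i
    have h := S.tangential i (q * f * X i g) (by
      rw [mul_assoc]; exact I.mul_mem_right _ hI)
    have e : X i (q * f * X i g) = q * f * X i (X i g) + q * (X i f * X i g) := by
      simp only [Derivation.leibniz, hq, smul_eq_mul]
      ring
    rw [e, map_add] at h
    linarith
  simp only [Lam, Gam, mul_smul_comm, map_smul, Finset.mul_sum, map_sum, h, Finset.sum_neg_distrib,
    smul_neg]

omit [Fintype ι] in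
lemma Setting.two_J_mul_radial (S : Setting E X J I) {q : R} (hI : q ∈ I) (w : R) :
    2 * J (q * w * E w) = -J (E q * w ^ 2) := by
  have h := S.radial _ (I.mul_mem_right (w ^ 2) hI)
  have e : E (q * w ^ 2) = E q * w ^ 2 + (q * w * E w + q * w * E w) := by
    simp only [pow_two, Derivation.leibniz, smul_eq_mul]
    ring
  rw [e, map_add, map_add] at h
  linarith

omit [Fintype ι] in
lemma Setting.two_J_mul_radial_two (S : Setting E X J I) {q : R} (hI : q ∈ I) (w : R) :
    2 * J (q * w * E (E w)) = -2 * J (q * E w ^ 2) + J (E (E q) * w ^ 2) := by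
  have h := S.radial _ (I.mul_mem_right (w * E w) hI)
  have e : E (q * (w * E w)) = E q * w * E w + q * E w ^ 2 + q * w * E (E w) := by
    simp only [Derivation.leibniz, smul_eq_mul]
    ring
  rw [e, map_add, map_add] at h
  linarith [S.two_J_mul_radial (S.stable _ hI) w]

omit [Fintype ι] in
lemma Setting.two_J_mul_radial_three (S : Setting E X J I) {q : R} (hI : q ∈ I) (w : R) :
    2 * J (q * w * E (E (E w))) = 3 * J (E q * E w ^ 2) - J (E (E (E q)) * w ^ 2) := by
  have h := S.radial _ (I.mul_mem_right (w * E (E w)) hI)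
  have e : E (q * (w * E (E w))) = E q * w * E (E w) + q * E w * E (E w) + q * w * E (E (E w)) := by
    simp only [Derivation.leibniz, smul_eq_mul]
    ring
  rw [e, map_add, map_add] at h
  linarith [S.two_J_mul_radial_two (S.stable _ hI) w, S.two_J_mul_radial hI (E w)]

omit [Fintype ι] in
lemma Setting.two_J_mul_radial_four (S : Setting E X J I) {q : R} (hI : q ∈ I) (w : R) :
    2 * J (q * w * E (E (E (E w)))) =
      2 * J (q * E (E w) ^ 2) - 4 * J (E (E q) * E w ^ 2) + J (E (E (E (E q))) * w ^ 2) := by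
  have h := S.radial _ (I.mul_mem_right (w * E (E (E w))) hI)
  have e : E (q * (w * E (E (E w)))) =
      E q * w * E (E (E w)) + q * E w * E (E (E w)) + q * w * E (E (E (E w))) := by
    simp only [Derivation.leibniz, smul_eq_mul]
    ring
  rw [e, map_add, map_add] at h
  linarith [S.two_J_mul_radial_three (S.stable _ hI) w, S.two_J_mul_radial_two hI (E w)]

lemma Setting.two_J_mul_Gam_radial (S : Setting E X J I) {q : R} (hI : q ∈ I) (w : R) :
    2 * J (q * Gam X w (E w)) = -J (E q * Gam X w w) := by
  have h := S.radial _ (I.mul_mem_right (Gam X w w) hI)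
  have e : E (q * Gam X w w) = E q * Gam X w w + (q * Gam X w (E w) + q * Gam X w (E w)) := by
    rw [Derivation.leibniz, S.radial_Gam, Gam_comm (E w) w]
    simp only [smul_eq_mul]
    ring
  rw [e, map_add, map_add] at h
  linarith

lemma Setting.two_J_mul_Gam_radial_two (S : Setting E X J I) {q : R} (hI : q ∈ I) (w : R) :
    2 * J (q * Gam X w (E (E w))) =
      -2 * J (q * Gam X (E w) (E w)) + J (E (E q) * Gam X w w) := by
  have h := S.radial _ (I.mul_mem_right (Gam X w (E w)) hI)
  have e : E (q * Gam X w (E w)) =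
      E q * Gam X w (E w) + q * Gam X (E w) (E w) + q * Gam X w (E (E w)) := by
    rw [Derivation.leibniz, S.radial_Gam]
    simp only [smul_eq_mul]
    ring
  rw [e, map_add, map_add] at h
  linarith [S.two_J_mul_Gam_radial (S.stable _ hI) w]

lemma Setting.J_mul_Lam_Lam (S : Setting E X J I) {q : R} (hq : ∀ i, X i q = 0) (hI : q ∈ I)
    (f g : R) : J (q * f * Lam X g) = J (q * g * Lam X f) := by
  rw [S.J_mul_Lam hq hI, S.J_mul_Lam hq hI, Gam_comm]

/-- The cylindrical form of the bilaplacian, with constant coefficients. -/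
noncomputable def cylOp (E : Derivation ℝ R R) (X : ι → Derivation ℝ R R) (c3 c2 c1 l1 l2 : ℝ)
    (w : R) : R :=
  E (E (E (E w))) + c3 • E (E (E w)) + c2 • E (E w) + c1 • E w + l2 • w
    + (2 : ℝ) • Lam X (E (E w)) + c3 • Lam X (E w) - l1 • Lam X w + Lam X (Lam X w)

lemma Setting.J_mul_cylOp (S : Setting E X J I) {q : R} (hq : ∀ i, X i q = 0) (hI : q ∈ I)
    (c3 c2 c1 l1 l2 : ℝ) (w : R) :
    J (q * w * cylOp E X c3 c2 c1 l1 l2 w) =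
      J (q * E (E w) ^ 2) + 2 * J (q * Gam X (E w) (E w)) + J (q * Lam X w ^ 2)
        + l1 * J (q * Gam X w w) + l2 * J (q * w ^ 2) - c2 * J (q * E w ^ 2)
        + (-2 * J (E (E q) * E w ^ 2) + J (E (E (E (E q))) * w ^ 2) / 2
          + 3 / 2 * c3 * J (E q * E w ^ 2) - c3 / 2 * J (E (E (E q)) * w ^ 2)
          + c2 / 2 * J (E (E q) * w ^ 2) - c1 / 2 * J (E q * w ^ 2)
          - J (E (E q) * Gam X w w) + c3 / 2 * J (E q * Gam X w w)) := by
  have h4 := S.two_J_mul_radial_four hI w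
  have h3 := S.two_J_mul_radial_three hI w
  have h2 := S.two_J_mul_radial_two hI w
  have h1 := S.two_J_mul_radial hI w
  have g2 := S.two_J_mul_Gam_radial_two hI w
  have g1 := S.two_J_mul_Gam_radial hI w
  have l2' := S.J_mul_Lam hq hI w (E (E w))
  have l1' := S.J_mul_Lam hq hI w (E w)
  have l0' := S.J_mul_Lam hq hI w w
  have ll := S.J_mul_Lam_Lam hq hI w (Lam X w)
  have e : q * Lam X w * Lam X w = q * Lam X w ^ 2 := by ring
  have e0 : q * w * w = q * w ^ 2 := by ring
  rw [e] at ll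
  simp only [cylOp, mul_add, mul_sub, mul_smul_comm, map_add, map_sub, map_smul, smul_eq_mul,
    e0, ll, l2', l1', l0']
  linear_combination h4 / 2 + c3 / 2 * h3 + c2 / 2 * h2 + c1 / 2 * h1 - g2 - c3 / 2 * g1

lemma Setting.J_mul_radial_cylOp (S : Setting E X J I) {q : R} (hq : ∀ i, X i q = 0) (hI : q ∈ I)
    (c3 c2 c1 l1 l2 : ℝ) (w : R) :
    J (q * E w * cylOp E X c3 c2 c1 l1 l2 w) =
      -(c3 * J (q * E (E w) ^ 2) + c3 * J (q * Gam X (E w) (E w)) - c1 * J (q * E w ^ 2))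
        + (3 / 2 * J (E q * E (E w) ^ 2) - J (E (E (E q)) * E w ^ 2) / 2
          + c3 / 2 * J (E (E q) * E w ^ 2) - c2 / 2 * J (E q * E w ^ 2)
          - l2 / 2 * J (E q * w ^ 2) + J (E q * Gam X (E w) (E w))
          - l1 / 2 * J (E q * Gam X w w) - J (E q * Lam X w ^ 2) / 2) := by
  have h4 := S.two_J_mul_radial_three hI (E w)
  have h3 := S.two_J_mul_radial_two hI (E w)
  have h2 := S.two_J_mul_radial hI (E w)
  have h1 := S.two_J_mul_radial hI w
  have g2 := S.two_J_mul_Gam_radial hI (E w)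
  have g1 := S.two_J_mul_Gam_radial hI w
  have l2' := S.J_mul_Lam hq hI (E w) (E (E w))
  have l1' := S.J_mul_Lam hq hI (E w) (E w)
  have l0' := S.J_mul_Lam hq hI (E w) w
  have ll := S.J_mul_Lam_Lam hq hI (E w) (Lam X w)
  have lr := S.two_J_mul_radial hI (Lam X w)
  rw [S.radial_Lam] at lr
  have e : q * E w * E w = q * E w ^ 2 := by ring
  have e0 : q * E w * w = q * w * E w := by ring
  rw [Gam_comm] at l0'
  simp only [cylOp, mul_add, mul_sub, mul_smul_comm, map_add, map_sub, map_smul, smul_eq_mul,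
    e, e0, ll, l2', l1', l0']
  linear_combination h4 / 2 + c3 / 2 * h3 + c2 / 2 * h2 + l2 / 2 * h1 - g2 + l1 / 2 * g1 + lr / 2

lemma Setting.J_Lam (S : Setting E X J I) {f : R} (hI : f ∈ I) (g : R) :
    J (f * Lam X g) = -J (Gam X f g) := by
  have h : ∀ i, J (f * X i (X i g)) = -J (X i f * X i g) := by
    intro i
    have h := S.tangential i _ (I.mul_mem_right (X i g) hI)
    have e : X i (f * X i g) = f * X i (X i g) + X i f * X i g := by
      simp only [Derivation.leibniz, smul_eq_mul]
      ring
    rw [e, map_add] at h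
    linarith
  simp only [Lam, Gam, mul_smul_comm, map_smul, Finset.mul_sum, map_sum, h, Finset.sum_neg_distrib,
    smul_neg]

lemma Setting.Gam_mem (S : Setting E X J I) {f : R} (hI : f ∈ I) (g : R) : Gam X f g ∈ I := by
  rw [Gam, Algebra.smul_def]
  exact I.mul_mem_left _ (I.sum_mem fun i _ => I.mul_mem_right _ (S.stable' i f hI))

/-- The cylindrical form of `Δ (r ^ (-(n - 4) / 2) f)`, with `κ = n (n - 4) / 4`. -/
noncomputable def stabOp (E : Derivation ℝ R R) (X : ι → Derivation ℝ R R) (κ : ℝ) (f : R) : R :=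
  E (E f) + (2 : ℝ) • E f - κ • f + Lam X f

lemma Setting.J_stabOp_sq (S : Setting E X J I) {h : R} (hh : ∀ i, X i h = 0) (hI : h ∈ I)
    (κ : ℝ) (w : R) :
    J (stabOp E X κ (h * w) ^ 2) =
      J (h ^ 2 * E (E w) ^ 2) + 2 * J (h ^ 2 * Gam X (E w) (E w)) + J (h ^ 2 * Lam X w ^ 2)
        + 2 * κ * J (h ^ 2 * Gam X w w) + κ ^ 2 * J (h ^ 2 * w ^ 2)
        + (4 + 2 * κ) * J (h ^ 2 * E w ^ 2)
        + (2 * J (E h ^ 2 * E w ^ 2) - 4 * J (h * E (E h) * E w ^ 2)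
          + J (h * E (E (E (E h))) * w ^ 2)
          - (4 + 2 * κ) * J (h * E (E h) * w ^ 2) - 2 * J (h * E (E h) * Gam X w w)) := by
  have hf : h * w ∈ I := I.mul_mem_right _ hI
  set f := h * w with hfdef
  have hf1 := S.stable _ hf
  have s12 := S.radial _ (I.mul_mem_right (E f) hf1)
  have s02 := S.radial _ (I.mul_mem_right (E f) hf)
  have s01 := S.radial _ (I.mul_mem_right f hf)
  have g11 := S.radial _ (S.Gam_mem hf1 f)
  have g01 := S.radial _ (S.Gam_mem hf f)
  have L2 := S.J_Lam (S.stable _ hf1) f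
  have L1 := S.J_Lam hf1 f
  have L0 := S.J_Lam hf f
  simp only [S.radial_Gam, Derivation.leibniz, smul_eq_mul, map_add] at s12 s02 s01 g11 g01
  rw [Gam_comm f (E f)] at g01
  have key : J (stabOp E X κ f ^ 2) = J (E (E f) ^ 2) + 2 * J (Gam X (E f) (E f)) + J (Lam X f ^ 2)
      + 2 * κ * J (Gam X f f) + κ ^ 2 * J (f ^ 2) + (4 + 2 * κ) * J (E f ^ 2) := by
    have e : stabOp E X κ f ^ 2 = E (E f) ^ 2 + (4 : ℝ) • E f ^ 2 + (κ ^ 2) • f ^ 2 + Lam X f ^ 2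
        + (4 : ℝ) • (E f * E (E f)) - (2 * κ) • (f * E (E f)) + (2 : ℝ) • (E (E f) * Lam X f)
        - (4 * κ) • (f * E f) + (4 : ℝ) • (E f * Lam X f) - (2 * κ) • (f * Lam X f) := by
      simp only [stabOp, Algebra.smul_def, map_mul, map_pow, map_ofNat]
      ring
    have e1 : E f * E f = E f ^ 2 := by ring
    rw [e1] at s02
    rw [e]
    simp only [map_add, map_sub, map_smul, smul_eq_mul, L2, L1, L0]
    linear_combination 2 * s12 - 2 * κ * s02 - 2 * κ * s01 - 2 * g11 - 2 * g01
  have hh1 := S.tangential_radial hh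
  have G : Gam X f f = h ^ 2 * Gam X w w := by
    rw [hfdef, Gam_mul hh, Gam_comm, Gam_mul hh]; ring
  have Ef : E f = h * E w + E h * w := by
    simp only [hfdef, Derivation.leibniz, smul_eq_mul]; ring
  have Gh : Gam X (E f) (E f) = h ^ 2 * Gam X (E w) (E w)
      + (h * E h * Gam X w (E w) + h * E h * Gam X w (E w)) + E h ^ 2 * Gam X w w := by
    rw [Ef, Gam_add, Gam_mul hh, Gam_mul hh1, Gam_comm, Gam_add, Gam_mul hh, Gam_mul hh1,
      Gam_comm w (_ + _), Gam_add, Gam_mul hh, Gam_mul hh1, Gam_comm (E w) w]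
    ring
  have Lf : Lam X f ^ 2 = h ^ 2 * Lam X w ^ 2 := by rw [hfdef, Lam_mul hh]; ring
  have Ef2 : E f ^ 2 = h ^ 2 * E w ^ 2 + (h * E h * w * E w + h * E h * w * E w)
      + E h ^ 2 * w ^ 2 := by rw [Ef]; ring
  have EEf : E (E f) = h * E (E w) + (E h * E w + E h * E w) + E (E h) * w := by
    rw [Ef]; simp only [map_add, Derivation.leibniz, smul_eq_mul]; ring
  have EEf2 : E (E f) ^ 2 = h ^ 2 * E (E w) ^ 2 + (E h ^ 2 * E w ^ 2 + E h ^ 2 * E w ^ 2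
      + E h ^ 2 * E w ^ 2 + E h ^ 2 * E w ^ 2) + E (E h) ^ 2 * w ^ 2
      + (h * E h * E w * E (E w) + h * E h * E w * E (E w) + h * E h * E w * E (E w)
        + h * E h * E w * E (E w))
      + (h * E (E h) * w * E (E w) + h * E (E h) * w * E (E w))
      + (E h * E (E h) * w * E w + E h * E (E h) * w * E w + E h * E (E h) * w * E w
        + E h * E (E h) * w * E w) := by rw [EEf]; ring
  have hI1 : h * E h ∈ I := I.mul_mem_right _ hI
  have hI2 : h * E (E h) ∈ I := I.mul_mem_right _ hI
  have hI3 : E h * E (E h) ∈ I := I.mul_mem_right _ (S.stable _ hI)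
  have i1 := S.two_J_mul_radial hI1 w
  have i2 := S.two_J_mul_radial hI1 (E w)
  have i3 := S.two_J_mul_radial_two hI2 w
  have i4 := S.two_J_mul_radial hI3 w
  have i5 := S.two_J_mul_Gam_radial hI1 w
  have d1 : E (h * E h) = E h ^ 2 + h * E (E h) := by
    simp only [Derivation.leibniz, smul_eq_mul]; ring
  have d2 : E (E h * E (E h)) = E (E h) ^ 2 + E h * E (E (E h)) := by
    simp only [Derivation.leibniz, smul_eq_mul]; ring
  have d3 : E (E (h * E (E h))) = E (E h) ^ 2 + (E h * E (E (E h)) + E h * E (E (E h)))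
      + h * E (E (E (E h))) := by
    simp only [map_add, Derivation.leibniz, smul_eq_mul]; ring
  rw [d1] at i1 i2 i5
  rw [d2] at i4
  rw [d3] at i3
  simp only [add_mul, map_add] at i1 i2 i3 i4 i5
  have e2 : f ^ 2 = h ^ 2 * w ^ 2 := by rw [hfdef]; ring
  rw [key, G, Gh, Lf, Ef2, EEf2, e2]
  simp only [map_add]
  linear_combination (4 + 2 * κ) * i1 + 2 * i2 + i3 + 2 * i4 + 2 * i5

end Identities

section Inequalities

variable {α ι : Type*} [Fintype ι] {R : Subalgebra ℝ (α → ℝ)}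

/-- A cutoff `h`, its companion weights `q₂`, `q₄` of slightly larger size, and the bounds on the
radial derivatives of `h` and `h²` in terms of them. -/
structure Cutoff (E : Derivation ℝ R R) (X : ι → Derivation ℝ R R) (I : Ideal R) (P : Set α)
    (c : ℝ) (h q2 q4 : R) : Prop where
  mem : h ∈ I
  mem' : q2 ∈ I
  radial : ∀ i, X i h = 0
  radial' : ∀ i, X i q2 = 0
  sq_le : ∀ x ∈ P, (h : α → ℝ) x ^ 2 ≤ (q2 : α → ℝ) x
  le : ∀ x ∈ P, (q2 : α → ℝ) x ≤ (q4 : α → ℝ) x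
  sq_eq : ∀ x ∈ P, (q2 : α → ℝ) x ^ 2 = (h : α → ℝ) x ^ 2 * (q4 : α → ℝ) x
  deriv_sq_one : ∀ x ∈ P, |(E (h ^ 2) : α → ℝ) x| ≤ c * (q2 : α → ℝ) x
  deriv_sq_two : ∀ x ∈ P, |(E (E (h ^ 2)) : α → ℝ) x| ≤ c * (q2 : α → ℝ) x
  deriv_sq_three : ∀ x ∈ P, |(E (E (E (h ^ 2))) : α → ℝ) x| ≤ c * (q4 : α → ℝ) x
  deriv_sq_four : ∀ x ∈ P, |(E (E (E (E (h ^ 2)))) : α → ℝ) x| ≤ c * (q4 : α → ℝ) x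
  deriv_one : ∀ x ∈ P, |(E h ^ 2 : R).1 x| ≤ c * (q2 : α → ℝ) x
  deriv_two : ∀ x ∈ P, |(h * E (E h) : R).1 x| ≤ c * (q2 : α → ℝ) x
  deriv_four : ∀ x ∈ P, |(h * E (E (E (E h))) : R).1 x| ≤ c * (q4 : α → ℝ) x
  deriv_two' : ∀ x ∈ P, |(E (E q2) : α → ℝ) x| ≤ c * (q4 : α → ℝ) x

variable {E : Derivation ℝ R R} {X : ι → Derivation ℝ R R} {J : R →ₗ[ℝ] ℝ} {I : Ideal R}
  {P : Set α} {c : ℝ} {h q2 q4 : R}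

lemma Gam_self_nonneg (f : R) (x : α) : 0 ≤ (Gam X f f).1 x := by
  simp only [Gam, SetLike.val_smul, Pi.smul_apply, smul_eq_mul, AddSubmonoidClass.coe_finsetSum,
    Finset.sum_apply, MulMemClass.coe_mul, Pi.mul_apply]
  have : 0 ≤ ∑ i, (X i f : α → ℝ) x * (X i f : α → ℝ) x :=
    Finset.sum_nonneg fun i _ => mul_self_nonneg _
  linarith

lemma sq_nonneg_apply (f : R) (x : α) : 0 ≤ (f ^ 2 : R).1 x := sq_nonneg (f.1 x)

/-- `J` is nonnegative on functions that are nonnegative on `P`. -/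
def PosOn (J : R →ₗ[ℝ] ℝ) (P : Set α) : Prop :=
  ∀ f : R, (∀ x ∈ P, 0 ≤ (f : α → ℝ) x) → 0 ≤ J f

lemma PosOn.mono (hJ : PosOn J P) {f g : R} (hfg : ∀ x ∈ P, (f : α → ℝ) x ≤ (g : α → ℝ) x) :
    J f ≤ J g := by
  have := hJ (g - f) fun x hx => sub_nonneg.2 (hfg x hx)
  rw [map_sub] at this
  linarith

lemma PosOn.mul_mono (hJ : PosOn J P) {f g k : R} (hfg : ∀ x ∈ P, (f : α → ℝ) x ≤ (g : α → ℝ) x)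
    (hk : ∀ x, 0 ≤ (k : α → ℝ) x) : J (f * k) ≤ J (g * k) :=
  hJ.mono fun x hx => mul_le_mul_of_nonneg_right (hfg x hx) (hk x)

lemma PosOn.abs_le (hJ : PosOn J P) {e q k : R} {d : ℝ}
    (he : ∀ x ∈ P, |(e : α → ℝ) x| ≤ d * (q : α → ℝ) x) (hk : ∀ x, 0 ≤ (k : α → ℝ) x) :
    |J (e * k)| ≤ d * J (q * k) := by
  have h1 : J (e * k) ≤ J (d • (q * k)) := hJ.mono fun x hx => by
    have := mul_le_mul_of_nonneg_right ((le_abs_self _).trans (he x hx)) (hk x)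
    simpa [mul_assoc] using this
  have h2 : J (-(e * k)) ≤ J (d • (q * k)) := hJ.mono fun x hx => by
    have := mul_le_mul_of_nonneg_right ((neg_le_abs _).trans (he x hx)) (hk x)
    simpa [mul_assoc] using this
  rw [map_neg] at h2
  rw [map_smul, smul_eq_mul] at h1 h2
  exact abs_le'.2 ⟨h1, h2⟩

omit [Fintype ι] in
lemma Cutoff.nonneg (C : Cutoff E X I P c h q2 q4) {x : α} (hx : x ∈ P) :
    0 ≤ (q2 : α → ℝ) x := (sq_nonneg _).trans (C.sq_le x hx)

omit [Fintype ι] in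
lemma Cutoff.nonneg' (C : Cutoff E X I P c h q2 q4) {x : α} (hx : x ∈ P) :
    0 ≤ (q4 : α → ℝ) x := (C.nonneg hx).trans (C.le x hx)

omit [Fintype ι] in
lemma Cutoff.sq_mem (C : Cutoff E X I P c h q2 q4) : h ^ 2 ∈ I := by
  rw [pow_two]; exact I.mul_mem_right _ C.mem

omit [Fintype ι] in
lemma Cutoff.sq_radial (C : Cutoff E X I P c h q2 q4) (i : ι) : X i (h ^ 2) = 0 := by
  simp [pow_two, C.radial i]

/-- The sum of the lower-order weighted integrals of `w`. -/
noncomputable def low (E : Derivation ℝ R R) (X : ι → Derivation ℝ R R) (J : R →ₗ[ℝ] ℝ)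
    (q2 q4 w : R) : ℝ :=
  J (q2 * E w ^ 2) + J (q2 * Gam X w w) + J (q4 * w ^ 2)

lemma Cutoff.low_nonneg (C : Cutoff E X I P c h q2 q4) (hJ : PosOn J P) (w : R) :
    0 ≤ J (q2 * E w ^ 2) ∧ 0 ≤ J (q2 * Gam X w w) ∧ 0 ≤ J (q4 * w ^ 2) :=
  ⟨hJ _ fun x hx => mul_nonneg (C.nonneg hx) (sq_nonneg_apply _ x),
    hJ _ fun x hx => mul_nonneg (C.nonneg hx) (Gam_self_nonneg _ x),
    hJ _ fun x hx => mul_nonneg (C.nonneg' hx) (sq_nonneg_apply _ x)⟩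

lemma abs_mul_le_of {a t B : ℝ} (ht : |t| ≤ B) : |a * t| ≤ |a| * B := by
  rw [abs_mul]; gcongr

lemma eq_neg_div_of_mul_add_eq_zero {a s t : ℝ} (ha : 0 < a) (h : a * s + t = 0) :
    s = -(t / a) := by
  field_simp
  linarith

/-- The second-order energy with weight `q`. -/
noncomputable def top (E : Derivation ℝ R R) (X : ι → Derivation ℝ R R) (J : R →ₗ[ℝ] ℝ)
    (q w : R) : ℝ :=
  J (q * E (E w) ^ 2) + 2 * J (q * Gam X (E w) (E w)) + J (q * Lam X w ^ 2)

lemma Cutoff.cylOp_bound (C : Cutoff E X I P c h q2 q4) (S : Setting E X J I) (hJ : PosOn J P)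
    (hc : 0 ≤ c) (c3 c2 c1 l1 l2 : ℝ) (w : R) :
    |J (h ^ 2 * w * cylOp E X c3 c2 c1 l1 l2 w) - (top E X J (h ^ 2) w
        + l1 * J (h ^ 2 * Gam X w w) + l2 * J (h ^ 2 * w ^ 2) - c2 * J (h ^ 2 * E w ^ 2))|
      ≤ 10 * (1 + |c3| + |c2| + |c1|) * (c * low E X J q2 q4 w) := by
  rw [S.J_mul_cylOp C.sq_radial C.sq_mem, top]
  obtain ⟨p1, p2, p3⟩ := C.low_nonneg hJ w
  set B := c * low E X J q2 q4 w with hB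
  have b1 : c * J (q2 * E w ^ 2) ≤ B := by
    rw [hB]; apply mul_le_mul_of_nonneg_left _ hc; rw [low]; linarith
  have b2 : c * J (q2 * Gam X w w) ≤ B := by
    rw [hB]; apply mul_le_mul_of_nonneg_left _ hc; rw [low]; linarith
  have b3 : c * J (q4 * w ^ 2) ≤ B := by
    rw [hB]; apply mul_le_mul_of_nonneg_left _ hc; rw [low]; linarith
  have up : ∀ e : R, (∀ x ∈ P, |(e : α → ℝ) x| ≤ c * (q2 : α → ℝ) x) →
      ∀ x ∈ P, |(e : α → ℝ) x| ≤ c * (q4 : α → ℝ) x := fun e he x hx =>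
    (he x hx).trans (mul_le_mul_of_nonneg_left (C.le x hx) hc)
  have t1 := (hJ.abs_le C.deriv_sq_two (sq_nonneg_apply (E w))).trans b1
  have t2 := (hJ.abs_le C.deriv_sq_four (sq_nonneg_apply w)).trans b3
  have t3 := abs_mul_le_of (a := c3) ((hJ.abs_le C.deriv_sq_one (sq_nonneg_apply (E w))).trans b1)
  have t4 := abs_mul_le_of (a := c3) ((hJ.abs_le C.deriv_sq_three (sq_nonneg_apply w)).trans b3)
  have t5 := abs_mul_le_of (a := c2)
    ((hJ.abs_le (up _ C.deriv_sq_two) (sq_nonneg_apply w)).trans b3)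
  have t6 := abs_mul_le_of (a := c1)
    ((hJ.abs_le (up _ C.deriv_sq_one) (sq_nonneg_apply w)).trans b3)
  have t7 := (hJ.abs_le C.deriv_sq_two (Gam_self_nonneg (X := X) w)).trans b2
  have t8 := abs_mul_le_of (a := c3)
    ((hJ.abs_le C.deriv_sq_one (Gam_self_nonneg (X := X) w)).trans b2)
  have hB0 : 0 ≤ B := (mul_nonneg hc p3).trans b3
  have m3 := mul_nonneg (abs_nonneg c3) hB0
  have m2 := mul_nonneg (abs_nonneg c2) hB0
  have m1 := mul_nonneg (abs_nonneg c1) hB0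
  rw [_root_.abs_le] at *
  constructor <;> linarith

lemma Cutoff.stabOp_bound (C : Cutoff E X I P c h q2 q4) (S : Setting E X J I) (hJ : PosOn J P)
    (hc : 0 ≤ c) (κ : ℝ) (w : R) :
    J (stabOp E X κ (h * w) ^ 2) ≤ top E X J (h ^ 2) w
        + 2 * κ * J (h ^ 2 * Gam X w w) + κ ^ 2 * J (h ^ 2 * w ^ 2)
        + (4 + 2 * κ) * J (h ^ 2 * E w ^ 2) + 20 * (1 + |κ|) * (c * low E X J q2 q4 w) := by
  rw [S.J_stabOp_sq C.radial C.mem, top]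
  obtain ⟨p1, p2, p3⟩ := C.low_nonneg hJ w
  set B := c * low E X J q2 q4 w with hB
  have b1 : c * J (q2 * E w ^ 2) ≤ B := by
    rw [hB]; apply mul_le_mul_of_nonneg_left _ hc; rw [low]; linarith
  have b2 : c * J (q2 * Gam X w w) ≤ B := by
    rw [hB]; apply mul_le_mul_of_nonneg_left _ hc; rw [low]; linarith
  have b3 : c * J (q4 * w ^ 2) ≤ B := by
    rw [hB]; apply mul_le_mul_of_nonneg_left _ hc; rw [low]; linarith
  have up : ∀ e : R, (∀ x ∈ P, |(e : α → ℝ) x| ≤ c * (q2 : α → ℝ) x) →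
      ∀ x ∈ P, |(e : α → ℝ) x| ≤ c * (q4 : α → ℝ) x := fun e he x hx =>
    (he x hx).trans (mul_le_mul_of_nonneg_left (C.le x hx) hc)
  have t1 := (hJ.abs_le C.deriv_one (sq_nonneg_apply (E w))).trans b1
  have t2 := (hJ.abs_le C.deriv_two (sq_nonneg_apply (E w))).trans b1
  have t3 := (hJ.abs_le C.deriv_four (sq_nonneg_apply w)).trans b3
  have t4 := (hJ.abs_le (up _ C.deriv_two) (sq_nonneg_apply w)).trans b3
  have t5 := abs_mul_le_of (a := κ) t4
  have t6 := (hJ.abs_le C.deriv_two (Gam_self_nonneg (X := X) w)).trans b2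
  have hB0 : 0 ≤ B := (mul_nonneg hc p3).trans b3
  have m3 := mul_nonneg (abs_nonneg κ) hB0
  rw [_root_.abs_le] at *
  linarith

/-- The full energy with weight `q`, for the nonlinearity `g`. -/
noncomputable def full (E : Derivation ℝ R R) (X : ι → Derivation ℝ R R) (J : R →ₗ[ℝ] ℝ)
    (q w g : R) : ℝ :=
  top E X J q w + J (q * E w ^ 2) + J (q * Gam X w w) + J (q * w ^ 2) + J (q * (w * g))

lemma PosOn.terms_nonneg (hJ : PosOn J P) {q w g : R} (hq : ∀ x ∈ P, 0 ≤ (q : α → ℝ) x)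
    (hg : ∀ x ∈ P, 0 ≤ (w * g : R).1 x) :
    0 ≤ J (q * E (E w) ^ 2) ∧ 0 ≤ J (q * Gam X (E w) (E w)) ∧ 0 ≤ J (q * Lam X w ^ 2) ∧
      0 ≤ J (q * E w ^ 2) ∧ 0 ≤ J (q * Gam X w w) ∧ 0 ≤ J (q * w ^ 2) ∧ 0 ≤ J (q * (w * g)) := by
  refine ⟨?_, ?_, ?_, ?_, ?_, ?_, ?_⟩ <;>
    refine hJ _ fun x hx => mul_nonneg (hq x hx) ?_
  exacts [sq_nonneg_apply _ x, Gam_self_nonneg _ x, sq_nonneg_apply _ x, sq_nonneg_apply _ x,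
    Gam_self_nonneg _ x, sq_nonneg_apply _ x, hg x hx]

set_option maxHeartbeats 400000 in
lemma Cutoff.pohozaev_bound (C : Cutoff E X I P c h q2 q4) (S : Setting E X J I)
    (hJ : PosOn J P) (hc : 0 ≤ c) {c3 c2 c1 l1 l2 p : ℝ} {w g Θ : R} (hp : 1 < p)
    (hg : g = cylOp E X c3 c2 c1 l1 l2 w) (hgE : E (w * g) = (p + 1) • (g * E w))
    (hg0 : ∀ x ∈ P, 0 ≤ (w * g : R).1 x) (hc3 : 0 ≤ c3)
    (hΘ : ∀ x ∈ P, (q4 : α → ℝ) x ≤ (Θ : α → ℝ) x) :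
    -c1 * J (h ^ 2 * E w ^ 2) ≤
      10 * (1 + |c3| + |c2| + |l1| + |l2|) * (c * full E X J Θ w g) := by
  have hid := S.J_mul_radial_cylOp C.sq_radial C.sq_mem c3 c2 c1 l1 l2 w
  rw [← hg] at hid
  have hN := S.radial _ (I.mul_mem_right (w * g) C.sq_mem)
  rw [Derivation.leibniz, hgE] at hN
  have e1 : h ^ 2 • ((p + 1) • (g * E w)) + (w * g) • E (h ^ 2)
      = (p + 1) • (h ^ 2 * E w * g) + E (h ^ 2) * (w * g) := by
    simp only [smul_eq_mul, Algebra.smul_def]; ring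
  rw [e1, map_add, map_smul, smul_eq_mul, hid] at hN
  have hq : ∀ x ∈ P, 0 ≤ (Θ : α → ℝ) x := fun x hx => (C.nonneg' hx).trans (hΘ x hx)
  obtain ⟨p1, p2, p3, p4, p5, p6, p7⟩ := hJ.terms_nonneg (E := E) (X := X) hq hg0
  obtain ⟨r1, r2, -⟩ := hJ.terms_nonneg (E := E) (X := X) (q := h ^ 2)
    (fun x _ => sq_nonneg_apply h x) hg0
  set B := c * full E X J Θ w g with hB
  have up : ∀ e : R, (∀ x ∈ P, |(e : α → ℝ) x| ≤ c * (q4 : α → ℝ) x) →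
      ∀ x ∈ P, |(e : α → ℝ) x| ≤ c * (Θ : α → ℝ) x := fun e he x hx =>
    (he x hx).trans (mul_le_mul_of_nonneg_left (hΘ x hx) hc)
  have up' : ∀ e : R, (∀ x ∈ P, |(e : α → ℝ) x| ≤ c * (q2 : α → ℝ) x) →
      ∀ x ∈ P, |(e : α → ℝ) x| ≤ c * (Θ : α → ℝ) x := fun e he =>
    up e fun x hx => (he x hx).trans (mul_le_mul_of_nonneg_left (C.le x hx) hc)
  have b : ∀ t : ℝ, t ≤ full E X J Θ w g → c * t ≤ B := fun t ht => by
    rw [hB]; exact mul_le_mul_of_nonneg_left ht hc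
  have t1 := (hJ.abs_le (up' _ C.deriv_sq_one) (sq_nonneg_apply (E (E w)))).trans
    (b _ (by rw [full, top]; linarith))
  have t2 := (hJ.abs_le (up _ C.deriv_sq_three) (sq_nonneg_apply (E w))).trans
    (b _ (by rw [full, top]; linarith))
  have t3 := abs_mul_le_of (a := c3)
    ((hJ.abs_le (up' _ C.deriv_sq_two) (sq_nonneg_apply (E w))).trans
    (b _ (by rw [full, top]; linarith)))
  have t4 := abs_mul_le_of (a := c2)
    ((hJ.abs_le (up' _ C.deriv_sq_one) (sq_nonneg_apply (E w))).trans
    (b _ (by rw [full, top]; linarith)))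
  have t5 := abs_mul_le_of (a := l2)
    ((hJ.abs_le (up' _ C.deriv_sq_one) (sq_nonneg_apply w)).trans
    (b _ (by rw [full, top]; linarith)))
  have t6 := (hJ.abs_le (up' _ C.deriv_sq_one) (Gam_self_nonneg (X := X) (E w))).trans
    (b _ (by rw [full, top]; linarith))
  have t7 := abs_mul_le_of (a := l1)
    ((hJ.abs_le (up' _ C.deriv_sq_one) (Gam_self_nonneg (X := X) w)).trans
    (b _ (by rw [full, top]; linarith)))
  have t8 := (hJ.abs_le (up' _ C.deriv_sq_one) (sq_nonneg_apply (Lam X w))).trans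
    (b _ (by rw [full, top]; linarith))
  have t9 : |J (E (h ^ 2) * (w * g))| ≤ B := by
    have h1 : J (E (h ^ 2) * (w * g)) ≤ J (c • (Θ * (w * g))) := hJ.mono fun x hx => by
      have := mul_le_mul_of_nonneg_right ((le_abs_self _).trans (up' _ C.deriv_sq_one x hx))
        (hg0 x hx)
      simpa [mul_assoc] using this
    have h2 : J (-(E (h ^ 2) * (w * g))) ≤ J (c • (Θ * (w * g))) := hJ.mono fun x hx => by
      have := mul_le_mul_of_nonneg_right ((neg_le_abs _).trans (up' _ C.deriv_sq_one x hx))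
        (hg0 x hx)
      simpa [mul_assoc] using this
    have h3 := b (J (Θ * (w * g))) (by rw [full, top]; linarith)
    rw [map_neg] at h2
    rw [map_smul, smul_eq_mul] at h1 h2
    exact abs_le'.2 ⟨h1.trans h3, h2.trans h3⟩
  have hB0 : 0 ≤ B := (abs_nonneg _).trans t9
  have hp1 : 0 < p + 1 := by linarith
  have hN' := eq_neg_div_of_mul_add_eq_zero hp1 hN
  have t10 : |J (E (h ^ 2) * (w * g)) / (p + 1)| ≤ B := by
    rw [abs_div, abs_of_pos hp1, div_le_iff₀ hp1]
    exact t9.trans (le_mul_of_one_le_right hB0 (by linarith))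
  have m3 := mul_nonneg (abs_nonneg c3) hB0
  have m2 := mul_nonneg (abs_nonneg c2) hB0
  have m1 := mul_nonneg (abs_nonneg l1) hB0
  have m0 := mul_nonneg (abs_nonneg l2) hB0
  have n1 := mul_nonneg hc3 r1
  have n2 := mul_nonneg hc3 r2
  clear hN hid hΘ hgE hg0 hq up up' b S hJ C p1 p2 p3 p4 p5 p6 p7 r1 r2 e1
  rw [_root_.abs_le] at *
  linarith

lemma Cutoff.interpolation (C : Cutoff E X I P c h q2 q4) (S : Setting E X J I) (hJ : PosOn J P)
    (w : R) {ε : ℝ} (hε : 0 < ε) :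
    J (q2 * E w ^ 2) + J (q2 * Gam X w w) ≤
      ε * top E X J (h ^ 2) w + (1 / ε + c) * J (q4 * w ^ 2) := by
  have i1 := S.two_J_mul_radial_two C.mem' w
  have i2 := S.J_mul_Lam C.radial' C.mem' w w
  have i3 := hJ.abs_le C.deriv_two' (sq_nonneg_apply w)
  have key : ∀ f : R,
      -J (q2 * w * f) ≤ ε / 2 * J (h ^ 2 * f ^ 2) + 1 / (2 * ε) * J (q4 * w ^ 2) := by
    intro f
    have := hJ.mono (f := -(q2 * w * f))
      (g := (ε / 2) • (h ^ 2 * f ^ 2) + (1 / (2 * ε)) • (q4 * w ^ 2)) (by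
        intro x hx
        have h1 := C.sq_eq x hx
        have h2 := C.nonneg' hx
        have h3 := C.nonneg hx
        change -((q2 : α → ℝ) x * (w : α → ℝ) x * (f : α → ℝ) x) ≤
          (ε / 2) * ((h : α → ℝ) x ^ 2 * (f : α → ℝ) x ^ 2)
            + (1 / (2 * ε)) * ((q4 : α → ℝ) x * (w : α → ℝ) x ^ 2)
        generalize (q2 : α → ℝ) x = a at *
        generalize (q4 : α → ℝ) x = b at *
        generalize (h : α → ℝ) x = k at *
        generalize (w : α → ℝ) x = u at *
        generalize (f : α → ℝ) x = v at *
        obtain ⟨s, hs, rfl⟩ : ∃ s : ℝ, 0 ≤ s ∧ b = s ^ 2 :=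
          ⟨√b, Real.sqrt_nonneg b, (Real.sq_sqrt h2).symm⟩
        have h4 : a = |k| * s := by
          rw [← abs_of_nonneg h3, ← abs_of_nonneg hs, ← abs_mul]
          exact (sq_eq_sq_iff_abs_eq_abs _ _).1 (by rw [h1]; ring)
        have h5 : 0 ≤ (ε * (|k| * v) + s * u) ^ 2 / (2 * ε) := by positivity
        have h6 : (ε * (|k| * v) + s * u) ^ 2 / (2 * ε) =
            ε / 2 * (k ^ 2 * v ^ 2) + |k| * s * u * v + 1 / (2 * ε) * (s ^ 2 * u ^ 2) := by
          field_simp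
          rw [← sq_abs k]
          ring
        rw [h4]
        linarith)
    simpa using this
  have k1 := key (E (E w))
  have k2 := key (Lam X w)
  have pg : 0 ≤ J (h ^ 2 * Gam X (E w) (E w)) := hJ _ fun x _ =>
    mul_nonneg (sq_nonneg_apply h x) (Gam_self_nonneg _ x)
  have p1 : 0 ≤ J (h ^ 2 * E (E w) ^ 2) := hJ _ fun x _ =>
    mul_nonneg (sq_nonneg_apply h x) (sq_nonneg_apply _ x)
  have p2 : 0 ≤ J (h ^ 2 * Lam X w ^ 2) := hJ _ fun x _ =>
    mul_nonneg (sq_nonneg_apply h x) (sq_nonneg_apply _ x)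
  have p3 : 0 ≤ J (q4 * w ^ 2) := hJ _ fun x hx =>
    mul_nonneg (C.nonneg' hx) (sq_nonneg_apply _ x)
  have a3 := (_root_.abs_le.1 i3).2
  have q1 := mul_nonneg hε.le pg
  have q2' := mul_nonneg hε.le p1
  have q3 := mul_nonneg hε.le p2
  have e1 : 1 / (2 * ε) = 1 / ε / 2 := by field_simp
  rw [e1] at k1 k2
  have hc : 0 ≤ c * J (q4 * w ^ 2) := (abs_nonneg _).trans i3
  rw [top]
  linarith

end Inequalities

section Closing

lemma exists_bound_of_young {p c2 l1 l2 κ c K1 K2 : ℝ} (hp : 1 < p) (hc : 0 ≤ c) (hK1 : 0 ≤ K1)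
    (hK2 : 0 ≤ K2) (D : ℝ → ℝ) :
    ∃ K : ℝ, ∀ T b1 b2 f B1 B2 F N Y : ℝ, 0 ≤ T → 0 ≤ B1 → 0 ≤ B2 → 0 ≤ F → 0 ≤ N →
      B1 ≤ b1 → B2 ≤ b2 → F ≤ f →
      |N - (T + l1 * B2 + l2 * F - c2 * B1)| ≤ K1 * (b1 + b2 + f) →
      p * N ≤ T + 2 * κ * B2 + κ ^ 2 * F + (4 + 2 * κ) * B1 + K2 * (b1 + b2 + f) →
      (∀ ε > 0, b1 + b2 ≤ ε * T + (1 / ε + c) * f) →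
      (∀ ε > 0, f ≤ ε * N + D ε * Y) →
      T + b1 + b2 + f + N ≤ K * Y := by
  obtain ⟨M0, hM0⟩ : ∃ M0 : ℝ, M0 = |l1| + |l2| + |c2| + K1 := ⟨_, rfl⟩
  have hM00 : 0 ≤ M0 := by rw [hM0]; positivity
  obtain ⟨M1, hM1⟩ : ∃ M1 : ℝ, M1 = 4 + 4 * |κ| + κ ^ 2 + K2 := ⟨_, rfl⟩
  have hM10 : 0 ≤ M1 := by rw [hM1]; positivity
  obtain ⟨M, hM⟩ : ∃ M : ℝ, M = p * M0 + M1 := ⟨_, rfl⟩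
  have hMp : 0 ≤ M := by rw [hM]; have := mul_nonneg (by linarith : 0 ≤ p) hM00; linarith
  have hq : 0 < p - 1 := by linarith
  obtain ⟨ε, hε⟩ : ∃ ε : ℝ, ε = (p - 1) / (2 * (M + 1)) := ⟨_, rfl⟩
  have hε0 : 0 < ε := by rw [hε]; positivity
  have hMε : M * ε ≤ (p - 1) / 2 := by
    rw [hε, mul_div_assoc', div_le_div_iff₀ (by positivity) (by norm_num)]
    nlinarith
  obtain ⟨M2, hM2⟩ : ∃ M2 : ℝ, M2 = 2 / (p - 1) * (M * (1 / ε + c + 1)) := ⟨_, rfl⟩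
  have hM20 : 0 ≤ M2 := by rw [hM2]; positivity
  obtain ⟨M3, hM3⟩ : ∃ M3 : ℝ, M3 = ε * M2 + (1 / ε + c) := ⟨_, rfl⟩
  have hM30 : 0 ≤ M3 := by rw [hM3]; positivity
  obtain ⟨M4, hM4⟩ : ∃ M4 : ℝ, M4 = M2 + M0 * (M3 + 1) := ⟨_, rfl⟩
  have hM40 : 0 ≤ M4 := by rw [hM4]; positivity
  obtain ⟨δ, hδ⟩ : ∃ δ : ℝ, δ = 1 / (2 * (M4 + 1)) := ⟨_, rfl⟩
  have hδ0 : 0 < δ := by rw [hδ]; positivity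
  have hδM : δ * M4 ≤ 1 / 2 := by
    rw [hδ, one_div_mul_eq_div, div_le_div_iff₀ (by positivity) (by norm_num)]
    nlinarith
  refine ⟨(M2 + M3 + 1 + M4) * (2 * D δ), ?_⟩
  intro T b1 b2 f B1 B2 F N Y hT hB1 hB2 hF hN h1 h2 h3 heq hst hint hyo
  have hb1 := hB1.trans h1
  have hb2 := hB2.trans h2
  have hf := hF.trans h3
  obtain ⟨s, hs⟩ : ∃ s : ℝ, s = b1 + b2 + f := ⟨_, rfl⟩
  have hB1s : B1 ≤ s := by linarith
  have hB2s : B2 ≤ s := by linarith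
  have hFs : F ≤ s := by linarith
  have bd : ∀ a t : ℝ, 0 ≤ t → t ≤ s → |a * t| ≤ |a| * s := fun a t h0 h => by
    rw [abs_mul, abs_of_nonneg h0]; gcongr
  have hNT : |N - T| ≤ M0 * s := by
    rw [← hs] at heq
    have e1 := bd l1 B2 hB2 hB2s
    have e2 := bd l2 F hF hFs
    have e3 := bd c2 B1 hB1 hB1s
    rw [abs_le] at *
    rw [hM0]
    constructor <;> linarith
  have hpN : p * N ≤ T + M1 * s := by
    rw [← hs] at hst
    have e1 := (abs_le.1 (bd κ B2 hB2 hB2s)).2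
    have e2 := (abs_le.1 (bd κ B1 hB1 hB1s)).2
    have e3 := mul_le_mul_of_nonneg_left hFs (sq_nonneg κ)
    rw [hM1]
    linarith
  obtain ⟨n1, n2⟩ := abs_le.1 hNT
  have hTs : (p - 1) * T ≤ M * s := by
    have := mul_le_mul_of_nonneg_left n1 (by linarith : 0 ≤ p)
    rw [hM]
    linarith
  have hi := hint ε hε0
  have hT2 : T ≤ M2 * f := by
    have e1 := mul_le_mul_of_nonneg_left hi hMp
    have e2 := mul_le_mul_of_nonneg_right hMε hT
    have e3 : (p - 1) / 2 * T ≤ M * (1 / ε + c + 1) * f := by rw [hs] at hTs; linarith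
    rw [hM2, mul_assoc, div_mul_eq_mul_div, le_div_iff₀ hq]
    linarith
  have hb3 : b1 + b2 ≤ M3 * f := by
    have := mul_le_mul_of_nonneg_left hT2 hε0.le
    rw [hM3]; linarith
  have hN4 : N ≤ M4 * f := by
    have : M0 * s ≤ M0 * ((M3 + 1) * f) := mul_le_mul_of_nonneg_left (by linarith) hM00
    rw [hM4]; linarith
  have hfY : f ≤ 2 * D δ * Y := by
    have e1 := mul_le_mul_of_nonneg_left hN4 hδ0.le
    have e2 := mul_le_mul_of_nonneg_right hδM hf
    linarith [hyo δ hδ0]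
  have := mul_le_mul_of_nonneg_left hfY (by positivity : 0 ≤ M2 + M3 + 1 + M4)
  linarith

lemma exists_bound_of_pohozaev {p c2 l1 l2 κ d : ℝ} (hp : 1 < p) (hd : 0 < d)
    (h1 : 0 < p * l1 - 2 * κ) (h2 : 0 < p * l2 - κ ^ 2) :
    ∃ K : ℝ, 0 ≤ K ∧ ∀ T B1 B2 F N e : ℝ, 0 ≤ T → 0 ≤ B1 → 0 ≤ B2 → 0 ≤ F → 
      |N - (T + l1 * B2 + l2 * F - c2 * B1)| ≤ e →
      p * N ≤ T + 2 * κ * B2 + κ ^ 2 * F + (4 + 2 * κ) * B1 + e →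
      d * B1 ≤ e → T + B1 + B2 + F + N ≤ K * e := by
  obtain ⟨m, hm⟩ : ∃ m : ℝ, m = min (p - 1) (min (p * l1 - 2 * κ) (p * l2 - κ ^ 2)) := ⟨_, rfl⟩
  have hm0 : 0 < m := by rw [hm]; exact lt_min (by linarith) (lt_min h1 h2)
  have m1 : m ≤ p - 1 := hm ▸ min_le_left _ _
  have m2 : m ≤ p * l1 - 2 * κ := hm ▸ (min_le_right _ _).trans (min_le_left _ _)
  have m3 : m ≤ p * l2 - κ ^ 2 := hm ▸ (min_le_right _ _).trans (min_le_right _ _)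
  obtain ⟨M, hM⟩ : ∃ M : ℝ, M = (p * |c2| + 4 + 2 * |κ|) / d + p + 1 := ⟨_, rfl⟩
  have hM0 : 0 ≤ M := by
    have : 0 ≤ p := by linarith
    rw [hM]; positivity
  refine ⟨M / m + 1 / d + (1 + |l1| + |l2|) * (M / m) + |c2| / d + 1, by positivity, ?_⟩
  intro T B1 B2 F N e hT hB1 hB2 hF heq hst hB
  obtain ⟨n1, n2⟩ := abs_le.1 heq
  have hBe : B1 ≤ e / d := by rw [le_div_iff₀ hd]; linarith
  have hsum : m * (T + B2 + F) ≤ M * e := by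
    have a1 := mul_le_mul_of_nonneg_right m1 hT
    have a2 := mul_le_mul_of_nonneg_right m2 hB2
    have a3 := mul_le_mul_of_nonneg_right m3 hF
    have a4 := mul_le_mul_of_nonneg_left n1 (by linarith : 0 ≤ p)
    have a5 : (p * c2 + 4 + 2 * κ) * B1 ≤ (p * |c2| + 4 + 2 * |κ|) * B1 := by
      have : p * c2 ≤ p * |c2| := mul_le_mul_of_nonneg_left (le_abs_self _) (by linarith)
      apply mul_le_mul_of_nonneg_right _ hB1
      linarith [le_abs_self κ]
    have a6 : (p * |c2| + 4 + 2 * |κ|) * B1 ≤ (p * |c2| + 4 + 2 * |κ|) * (e / d) :=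
      mul_le_mul_of_nonneg_left hBe (by
        have : 0 ≤ p := by linarith
        positivity)
    have a7 : (p * |c2| + 4 + 2 * |κ|) / d * e = (p * |c2| + 4 + 2 * |κ|) * (e / d) := by ring
    rw [hM, add_mul, add_mul, a7]
    linarith
  have hsum' : T + B2 + F ≤ M / m * e := by
    rw [div_mul_eq_mul_div, le_div_iff₀ hm0]; linarith
  have hN : N ≤ T + |l1| * B2 + |l2| * F + |c2| * B1 + e := by
    have b1 := mul_le_mul_of_nonneg_right (le_abs_self l1) hB2
    have b2 := mul_le_mul_of_nonneg_right (le_abs_self l2) hF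
    have b3 := mul_le_mul_of_nonneg_right (neg_le_abs c2) hB1
    linarith
  have hc2 := mul_le_mul_of_nonneg_left hBe (abs_nonneg c2)
  have hl1 : |l1| * B2 ≤ |l1| * (M / m * e) :=
    mul_le_mul_of_nonneg_left (by linarith) (abs_nonneg _)
  have hl2 : |l2| * F ≤ |l2| * (M / m * e) :=
    mul_le_mul_of_nonneg_left (by linarith) (abs_nonneg _)
  have r1 : |c2| / d * e = |c2| * (e / d) := by ring
  have r2 : 1 / d * e = e / d := by ring
  have r3 : (1 + |l1| + |l2|) * (M / m) * e
    = M / m * e + |l1| * (M / m * e) + |l2| * (M / m * e) := by ring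
  have hT' : T ≤ M / m * e := by linarith
  rw [add_mul, add_mul, add_mul, add_mul, r1, r2, r3]
  linarith

variable {α ι : Type*} [Fintype ι] {R : Subalgebra ℝ (α → ℝ)}
  {E : Derivation ℝ R R} {X : ι → Derivation ℝ R R} {P : Set α}

lemma exists_full_le_of_young {p c3 c2 c1 l1 l2 κ c₀ : ℝ} (hp : 1 < p) (hc₀ : 0 ≤ c₀)
    (D : ℝ → ℝ) {w g : R} (hg : g = cylOp E X c3 c2 c1 l1 l2 w)
    (hg0 : ∀ x ∈ P, 0 ≤ (w * g : R).1 x) :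
    ∃ K : ℝ, ∀ (J : R →ₗ[ℝ] ℝ) (I : Ideal R) (h q2 q4 : R) (c : ℝ), Setting E X J I → PosOn J P →
      0 ≤ c → c ≤ c₀ → Cutoff E X I P c h q2 q4 →
      p * J (h ^ 2 * (w * g)) ≤ J (stabOp E X κ (h * w) ^ 2) →
      (∀ ε > 0, ∀ x ∈ P, (q4 * w ^ 2 : R).1 x ≤ ε * (h ^ 2 * (w * g) : R).1 x + D ε) →
      full E X J (h ^ 2) w g ≤ K * J 1 := by
  obtain ⟨K, hK⟩ := exists_bound_of_young (p := p) (c2 := c2) (l1 := l1) (l2 := l2) (κ := κ)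
    (c := c₀) (K1 := 10 * (1 + |c3| + |c2| + |c1|) * c₀) (K2 := 20 * (1 + |κ|) * c₀) hp hc₀
    (by positivity) (by positivity) D
  refine ⟨K, fun J I h q2 q4 c S hJ hc hcc C hst hY => ?_⟩
  have hh : ∀ x ∈ P, 0 ≤ (h ^ 2 : R).1 x := fun x _ => sq_nonneg_apply h x
  obtain ⟨p1, p2, p3, p4, p5, p6, p7⟩ := hJ.terms_nonneg (E := E) (X := X) hh hg0
  obtain ⟨r1, r2, r3⟩ := C.low_nonneg hJ w
  have k1 := C.cylOp_bound S hJ hc c3 c2 c1 l1 l2 w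
  have k2 := C.stabOp_bound S hJ hc κ w
  rw [← hg, mul_assoc] at k1
  have hlow : c * low E X J q2 q4 w ≤ c₀ * low E X J q2 q4 w :=
    mul_le_mul_of_nonneg_right hcc (by rw [low]; positivity)
  have s1 : J (h ^ 2 * E w ^ 2) ≤ J (q2 * E w ^ 2) := hJ.mul_mono C.sq_le (sq_nonneg_apply _)
  have s2 : J (h ^ 2 * Gam X w w) ≤ J (q2 * Gam X w w) :=
    hJ.mul_mono C.sq_le (Gam_self_nonneg _)
  have s3 : J (h ^ 2 * w ^ 2) ≤ J (q4 * w ^ 2) :=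
    hJ.mul_mono (fun x hx => (C.sq_le x hx).trans (C.le x hx)) (sq_nonneg_apply _)
  have := hK (top E X J (h ^ 2) w) (J (q2 * E w ^ 2)) (J (q2 * Gam X w w)) (J (q4 * w ^ 2))
    (J (h ^ 2 * E w ^ 2)) (J (h ^ 2 * Gam X w w)) (J (h ^ 2 * w ^ 2)) (J (h ^ 2 * (w * g)))
    (J 1) (by rw [top]; positivity) p4 p5 p6 p7 s1 s2 s3
    (k1.trans (by
      rw [mul_assoc _ c₀]
      exact mul_le_mul_of_nonneg_left hlow (by positivity)))
    ((hst.trans k2).trans (by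
      have := mul_le_mul_of_nonneg_left hlow (by positivity : 0 ≤ 20 * (1 + |κ|))
      rw [mul_assoc _ c₀, ← low]
      linarith))
    (fun ε hε => (C.interpolation S hJ w hε).trans (by
      have := mul_le_mul_of_nonneg_right hcc r3
      linarith))
    (fun ε hε => by
      have := hJ.mono (f := q4 * w ^ 2) (g := ε • (h ^ 2 * (w * g)) + D ε • 1) (by
        intro x hx
        have := hY ε hε x hx
        simpa using this)
      simpa using this)
  rw [full]
  linarith

lemma exists_full_le_of_pohozaev {p c3 c2 c1 l1 l2 κ : ℝ} (hp : 1 < p) (hc3 : 0 ≤ c3)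
    (hc1 : c1 < 0) (h1 : 0 < p * l1 - 2 * κ) (h2 : 0 < p * l2 - κ ^ 2) {w g : R}
    (hg : g = cylOp E X c3 c2 c1 l1 l2 w) (hg0 : ∀ x ∈ P, 0 ≤ (w * g : R).1 x)
    (hgE : E (w * g) = (p + 1) • (g * E w)) :
    ∃ K : ℝ, 0 ≤ K ∧ ∀ (J : R →ₗ[ℝ] ℝ) (I : Ideal R) (h q2 q4 Θ : R) (c : ℝ), Setting E X J I →
      PosOn J P → 0 ≤ c → Cutoff E X I P c h q2 q4 →
      p * J (h ^ 2 * (w * g)) ≤ J (stabOp E X κ (h * w) ^ 2) →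
      (∀ x ∈ P, (q4 : α → ℝ) x ≤ (Θ : α → ℝ) x) →
      full E X J (h ^ 2) w g ≤ K * (c * full E X J Θ w g) := by
  obtain ⟨K, hK0, hK⟩ := exists_bound_of_pohozaev (p := p) (c2 := c2) (l1 := l1) (l2 := l2)
    (κ := κ) (d := -c1) hp (by linarith) h1 h2
  obtain ⟨K1, hK1⟩ : ∃ K1 : ℝ, K1 = 10 * (1 + |c3| + |c2| + |c1|) + 20 * (1 + |κ|)
    + 10 * (1 + |c3| + |c2| + |l1| + |l2|) := ⟨_, rfl⟩
  have hK10 : 0 ≤ K1 := by rw [hK1]; positivity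
  refine ⟨K * K1, by positivity, fun J I h q2 q4 Θ c S hJ hc C hst hΘ => ?_⟩
  have hh : ∀ x ∈ P, 0 ≤ (h ^ 2 : R).1 x := fun x _ => sq_nonneg_apply h x
  have hΘ0 : ∀ x ∈ P, 0 ≤ (Θ : α → ℝ) x := fun x hx => (C.nonneg' hx).trans (hΘ x hx)
  obtain ⟨p1, p2, p3, p4, p5, p6, p7⟩ := hJ.terms_nonneg (E := E) (X := X) hh hg0
  obtain ⟨q1, q2', q3, q4', q5, q6, q7⟩ := hJ.terms_nonneg (E := E) (X := X) hΘ0 hg0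
  have k1 := C.cylOp_bound S hJ hc c3 c2 c1 l1 l2 w
  have k2 := C.stabOp_bound S hJ hc κ w
  have k3 := C.pohozaev_bound S hJ hc hp hg hgE hg0 hc3 hΘ
  rw [← hg, mul_assoc] at k1
  have hlow : low E X J q2 q4 w ≤ full E X J Θ w g := by
    have s1 : J (q2 * E w ^ 2) ≤ J (Θ * E w ^ 2) :=
      hJ.mul_mono (fun x hx => (C.le x hx).trans (hΘ x hx)) (sq_nonneg_apply _)
    have s2 : J (q2 * Gam X w w) ≤ J (Θ * Gam X w w) :=
      hJ.mul_mono (fun x hx => (C.le x hx).trans (hΘ x hx)) (Gam_self_nonneg _)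
    have s3 : J (q4 * w ^ 2) ≤ J (Θ * w ^ 2) := hJ.mul_mono hΘ (sq_nonneg_apply _)
    rw [low, full, top]
    linarith
  have hfull : 0 ≤ full E X J Θ w g := by rw [full, top]; positivity
  have hcl := mul_le_mul_of_nonneg_left hlow hc
  have hcf := mul_nonneg hc hfull
  have e1 := mul_le_mul_of_nonneg_left hcl (by positivity : 0 ≤ 10 * (1 + |c3| + |c2| + |c1|))
  have e2 := mul_le_mul_of_nonneg_left hcl (by positivity : 0 ≤ 20 * (1 + |κ|))
  have f1 := mul_nonneg (by positivity : 0 ≤ 10 * (1 + |c3| + |c2| + |c1|)) hcf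
  have f2 := mul_nonneg (by positivity : 0 ≤ 20 * (1 + |κ|)) hcf
  have f3 := mul_nonneg (by positivity : 0 ≤ 10 * (1 + |c3| + |c2| + |l1| + |l2|)) hcf
  have hK1e : K1 * (c * full E X J Θ w g) =
      10 * (1 + |c3| + |c2| + |c1|) * (c * full E X J Θ w g)
      + 20 * (1 + |κ|) * (c * full E X J Θ w g)
      + 10 * (1 + |c3| + |c2| + |l1| + |l2|) * (c * full E X J Θ w g) := by
    rw [hK1, add_mul, add_mul]
  have := hK (top E X J (h ^ 2) w)
    (J (h ^ 2 * E w ^ 2)) (J (h ^ 2 * Gam X w w)) (J (h ^ 2 * w ^ 2)) (J (h ^ 2 * (w * g)))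
    (K1 * (c * full E X J Θ w g)) (by rw [top]; positivity) p4 p5 p6
    (k1.trans (by rw [hK1e]; linarith)) (by rw [hK1e]; linarith) (by rw [hK1e]; linarith)
  rw [full, mul_assoc]
  linarith

end Closing

section SmoothOff

open scoped ContDiff

variable {V : Type*} [NormedAddCommGroup V] [InnerProductSpace ℝ V]

variable (V) in
/-- The algebra of functions that are smooth away from the origin. -/
def smoothOff : Subalgebra ℝ (V → ℝ) where
  carrier := {f | ∀ x ≠ 0, ContDiffAt ℝ ∞ f x}
  mul_mem' hf hg x hx := (hf x hx).mul (hg x hx)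
  add_mem' hf hg x hx := (hf x hx).add (hg x hx)
  algebraMap_mem' _ _ _ := contDiffAt_const

lemma smoothOff_contDiffAt (f : smoothOff V) {x : V} (hx : x ≠ 0) : ContDiffAt ℝ ∞ f.1 x :=
  f.2 x hx

lemma smoothOff_differentiableAt (f : smoothOff V) {x : V} (hx : x ≠ 0) :
    DifferentiableAt ℝ f.1 x :=
  (smoothOff_contDiffAt f hx).differentiableAt (by simp)

lemma smoothOff_differentiableAt_fderiv (f : smoothOff V) {x : V} (hx : x ≠ 0) :
    DifferentiableAt ℝ (fderiv ℝ f.1) x :=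
  ((smoothOff_contDiffAt f hx).fderiv_right (m := 1) (by norm_cast)).differentiableAt (by simp)

lemma smoothOff_fderiv_symm (f : smoothOff V) {x : V} (hx : x ≠ 0) (v w : V) :
    fderiv ℝ (fderiv ℝ f.1) x v w = fderiv ℝ (fderiv ℝ f.1) x w v := by
  refine ((smoothOff_contDiffAt f hx).isSymmSndFDerivAt ?_).eq v w
  rw [minSmoothness_of_isRCLikeNormedField]
  exact WithTop.coe_le_coe.2 (le_top : (2 : ℕ∞) ≤ ⊤)

/-- The derivation along the linear vector field `x ↦ A x`. -/
noncomputable def linDer (A : V →L[ℝ] V) : Derivation ℝ (smoothOff V) (smoothOff V) where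
  toFun f := ⟨fun x => fderiv ℝ f.1 x (A x), fun x hx =>
    ((smoothOff_contDiffAt f hx).fderiv_right (m := ∞) (by simp)).clm_apply A.contDiff.contDiffAt⟩
  map_add' f g := by
    ext x
    rcases eq_or_ne x 0 with rfl | hx
    · simp
    · simpa using DFunLike.congr_fun (fderiv_add (smoothOff_differentiableAt f hx)
        (smoothOff_differentiableAt g hx)) (A x)
  map_smul' c f := by
    ext x
    rcases eq_or_ne x 0 with rfl | hx
    · simp
    · simpa using DFunLike.congr_fun (fderiv_const_smul (smoothOff_differentiableAt f hx) c) (A x)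
  map_one_eq_zero' := by
    ext x
    simp
  leibniz' f g := by
    ext x
    rcases eq_or_ne x 0 with rfl | hx
    · simp
    · simpa using DFunLike.congr_fun (fderiv_mul (smoothOff_differentiableAt f hx)
        (smoothOff_differentiableAt g hx)) (A x)

lemma linDer_apply (A : V →L[ℝ] V) (f : smoothOff V) (x : V) :
    (linDer A f).1 x = fderiv ℝ f.1 x (A x) := rfl

lemma linDer_linDer_apply (A B : V →L[ℝ] V) (f : smoothOff V) {x : V} (hx : x ≠ 0) :
    (linDer A (linDer B f)).1 x =
      fderiv ℝ (fderiv ℝ f.1) x (A x) (B x) + fderiv ℝ f.1 x (B (A x)) := by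
  have h := ((smoothOff_differentiableAt_fderiv f hx).hasFDerivAt.clm_apply
    (B.hasFDerivAt (x := x))).fderiv
  rw [linDer_apply]
  change fderiv ℝ (fun y => fderiv ℝ f.1 y (B y)) x (A x) = _
  rw [h]
  simp [add_comm]

lemma linDer_comm {A B : V →L[ℝ] V} (h : ∀ x, A (B x) = B (A x)) (f : smoothOff V) :
    linDer A (linDer B f) = linDer B (linDer A f) := by
  ext x
  rcases eq_or_ne x 0 with rfl | hx
  · simp [linDer_apply]
  · rw [linDer_linDer_apply _ _ _ hx, linDer_linDer_apply _ _ _ hx, h,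
      smoothOff_fderiv_symm f hx]

open Classical in
/-- The radial function `x ↦ φ (log ‖x‖)`, extended by zero to the origin. -/
noncomputable def rad {φ : ℝ → ℝ} (hφ : ContDiff ℝ ∞ φ) : smoothOff V :=
  ⟨fun x => if x = 0 then 0 else φ (Real.log ‖x‖), fun x hx => by
    have : ContDiffAt ℝ ∞ (fun x : V => φ (Real.log ‖x‖)) x :=
      hφ.contDiffAt.comp x ((contDiffAt_id.norm ℝ hx).log (norm_ne_zero_iff.2 hx))
    refine this.congr_of_eventuallyEq ?_
    filter_upwards [isOpen_ne.mem_nhds hx] with y hy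
    simp [show y ≠ 0 from hy]⟩

lemma rad_apply {φ : ℝ → ℝ} (hφ : ContDiff ℝ ∞ φ) {x : V} (hx : x ≠ 0) :
    (rad hφ).1 x = φ (Real.log ‖x‖) := by
  simp [rad, hx]

lemma rad_zero {φ : ℝ → ℝ} (hφ : ContDiff ℝ ∞ φ) : (rad hφ).1 (0 : V) = 0 := by
  simp [rad]

lemma linDer_rad {φ : ℝ → ℝ} (hφ : ContDiff ℝ ∞ φ) (A : V →L[ℝ] V) {x : V} (hx : x ≠ 0) :
    (linDer A (rad hφ)).1 x = deriv φ (Real.log ‖x‖) * (inner ℝ x (A x) / ‖x‖ ^ 2) := by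
  have hx' := norm_ne_zero_iff.2 hx
  have e : (rad hφ).1 =ᶠ[𝓝 x] fun y => φ ((1 / 2) * Real.log (‖y‖ ^ 2)) := by
    filter_upwards [isOpen_ne.mem_nhds hx] with y hy
    rw [rad_apply hφ hy, Real.log_pow]
    congr 1
    push_cast
    ring
  have hd : HasFDerivAt (fun y : V => φ ((1 / 2) * Real.log (‖y‖ ^ 2)))
      (deriv φ ((1 / 2) * Real.log (‖x‖ ^ 2)) •
        ((1 / 2 : ℝ) • ((‖x‖ ^ 2)⁻¹ • ((2 : ℝ) • innerSL ℝ x)))) x := by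
    have h1 : HasFDerivAt (fun y : V => ‖y‖ ^ 2) ((2 : ℝ) • innerSL ℝ x) x := by
      simpa [two_smul] using (hasStrictFDerivAt_norm_sq x).hasFDerivAt
    have h2 := (h1.log (pow_ne_zero 2 hx')).const_mul (1 / 2)
    exact (hφ.differentiable (by simp) _).hasDerivAt.comp_hasFDerivAt x h2
  rw [linDer_apply, e.fderiv_eq, hd.fderiv, Real.log_pow]
  have : (1 / 2 : ℝ) * ((2 : ℕ) * Real.log ‖x‖) = Real.log ‖x‖ := by push_cast; ring
  rw [this]
  simp only [smul_apply, innerSL_apply_apply, smul_eq_mul]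
  ring

lemma linDer_id_rad {φ φ' : ℝ → ℝ} (hφ : ContDiff ℝ ∞ φ) (hφ' : ContDiff ℝ ∞ φ')
    (h : ∀ t, HasDerivAt φ (φ' t) t) :
    linDer (ContinuousLinearMap.id ℝ V) (rad hφ) = rad hφ' := by
  ext x
  rcases eq_or_ne x 0 with rfl | hx
  · simp [linDer_apply, rad_zero]
  · have hx' := norm_ne_zero_iff.2 hx
    rw [linDer_rad hφ _ hx, rad_apply hφ' hx, (h _).deriv]
    simp [hx']

lemma linDer_rad_eq_zero {φ : ℝ → ℝ} (hφ : ContDiff ℝ ∞ φ) {A : V →L[ℝ] V}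
    (hA : ∀ x, inner ℝ x (A x) = 0) : linDer A (rad hφ) = 0 := by
  ext x
  rcases eq_or_ne x 0 with rfl | hx
  · simp [linDer_apply]
  · simp [linDer_rad hφ _ hx, hA]

/-- The power function `x ↦ ‖x‖ ^ s` away from the origin. -/
noncomputable def normPow (s : ℝ) : smoothOff V :=
  rad (φ := fun t => Real.exp (s * t)) (by fun_prop)

lemma normPow_apply (s : ℝ) {x : V} (hx : x ≠ 0) : (normPow s).1 x = ‖x‖ ^ s := by
  rw [normPow, rad_apply _ hx, Real.rpow_def_of_pos (norm_pos_iff.2 hx), mul_comm]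

lemma linDer_id_normPow (s : ℝ) :
    linDer (ContinuousLinearMap.id ℝ V) (normPow s) = s • normPow s := by
  rw [normPow, linDer_id_rad (φ' := fun t => s * Real.exp (s * t)) _ (by fun_prop)]
  · ext x
    rcases eq_or_ne x 0 with rfl | hx
    · simp [rad_zero]
    · simp [rad_apply _ hx]
  · intro t
    have := ((hasDerivAt_id t).const_mul s).exp
    simpa [mul_comm] using this

lemma normPow_mul (s t : ℝ) : (normPow s * normPow t : smoothOff V) = normPow (s + t) := by
  ext x
  rcases eq_or_ne x 0 with rfl | hx
  · simp [normPow, rad_zero]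
  · simp [normPow_apply _ hx, Real.rpow_add (norm_pos_iff.2 hx)]

end SmoothOff

section Laplacian

variable {n : ℕ}

variable (n) in
/-- The radial vector field, as a derivation. -/
noncomputable def euler : Derivation ℝ (smoothOff (EuclideanSpace ℝ (Fin n)))
    (smoothOff (EuclideanSpace ℝ (Fin n))) :=
  linDer (ContinuousLinearMap.id ℝ _)

/-- The infinitesimal rotation in a coordinate plane. -/
noncomputable def rotMap (k : Fin n × Fin n) :
    EuclideanSpace ℝ (Fin n) →L[ℝ] EuclideanSpace ℝ (Fin n) :=
  (EuclideanSpace.proj k.1 : _ →L[ℝ] ℝ).smulRight (EuclideanSpace.single k.2 1) -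
    (EuclideanSpace.proj k.2 : _ →L[ℝ] ℝ).smulRight (EuclideanSpace.single k.1 1)

lemma rotMap_apply (i j : Fin n) (x : EuclideanSpace ℝ (Fin n)) :
    rotMap (i, j) x = x i • EuclideanSpace.single j 1 - x j • EuclideanSpace.single i 1 := by
  simp [rotMap]

/-- The infinitesimal rotations, as derivations. -/
noncomputable def rot (k : Fin n × Fin n) : Derivation ℝ (smoothOff (EuclideanSpace ℝ (Fin n)))
    (smoothOff (EuclideanSpace ℝ (Fin n))) :=
  linDer (rotMap k)

lemma inner_rotMap (k : Fin n × Fin n) (x : EuclideanSpace ℝ (Fin n)) :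
    inner ℝ x (rotMap k x) = 0 := by
  obtain ⟨i, j⟩ := k
  rw [rotMap_apply, inner_sub_right, inner_smul_right, inner_smul_right,
    EuclideanSpace.inner_single_right, EuclideanSpace.inner_single_right]
  simp
  ring

lemma euler_rot (k : Fin n × Fin n) (f : smoothOff (EuclideanSpace ℝ (Fin n))) :
    euler n (rot k f) = rot k (euler n f) :=
  linDer_comm (A := ContinuousLinearMap.id ℝ _) (B := rotMap k) (fun _ => rfl) f

lemma sum_smul_single (x : EuclideanSpace ℝ (Fin n)) :
    ∑ i, x i • EuclideanSpace.single i (1 : ℝ) = x := by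
  ext j
  simp [Pi.single_apply]

lemma Lam_rot_apply (f : smoothOff (EuclideanSpace ℝ (Fin n))) {x : EuclideanSpace ℝ (Fin n)}
    (hx : x ≠ 0) :
    (Lam rot f).1 x = ‖x‖ ^ 2 * lap n f.1 x - fderiv ℝ (fderiv ℝ f.1) x x x
      - (n - 1) * fderiv ℝ f.1 x x := by
  set B := fderiv ℝ (fderiv ℝ f.1) x with hB
  set D := fderiv ℝ f.1 x with hD
  have hsymm : ∀ v w, B v w = B w v := smoothOff_fderiv_symm f hx
  set e : Fin n → EuclideanSpace ℝ (Fin n) := fun i => EuclideanSpace.single i 1 with he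
  have hxe : ∑ i, x i • e i = x := sum_smul_single x
  have hlap : lap n f.1 x = ∑ i, B (e i) (e i) := by
    simp [lap, iteratedFDeriv_two_apply, hB, he]
  have hterm : ∀ i j, (rot (i, j) (rot (i, j) f)).1 x =
      x i ^ 2 * B (e j) (e j) - 2 * (x i * x j * B (e i) (e j)) + x j ^ 2 * B (e i) (e i)
      + ((if i = j then x i else 0) * D (e j) - x j * D (e j)
        - (x i * D (e i) - (if i = j then x j else 0) * D (e i))) := by
    intro i j
    rw [rot, linDer_linDer_apply _ _ _ hx, rotMap_apply, ← hB, ← hD, rotMap_apply]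
    simp only [map_sub, map_smul, _root_.sub_apply, _root_.smul_apply,
      smul_eq_mul]
    rw [hsymm (EuclideanSpace.single j 1) (EuclideanSpace.single i 1)]
    have e1 : (x i • EuclideanSpace.single j (1 : ℝ) - x j • EuclideanSpace.single i 1 :
      EuclideanSpace ℝ (Fin n)) i = (if i = j then x i else 0) - x j := by
      simp
    have e2 : (x i • EuclideanSpace.single j (1 : ℝ) - x j • EuclideanSpace.single i 1 :
      EuclideanSpace ℝ (Fin n)) j = x i - (if i = j then x j else 0) := by
      simp [eq_comm]
    rw [e1, e2]
    ring
  have s1 : ∑ i, ∑ j, x i ^ 2 * B (e j) (e j) = ‖x‖ ^ 2 * lap n f.1 x := by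
    rw [hlap, EuclideanSpace.real_norm_sq_eq, Finset.sum_mul_sum]
  have s2 : ∑ i, ∑ j, x i * x j * B (e i) (e j) = B x x := by
    conv_rhs => rw [← hxe]
    simp only [map_sum, map_smul, _root_.sum_apply, _root_.smul_apply,
      smul_eq_mul, Finset.mul_sum]
    rw [Finset.sum_comm]
    refine Finset.sum_congr rfl fun i _ => Finset.sum_congr rfl fun j _ => ?_
    ring
  have s3 : ∑ i, ∑ j, x j ^ 2 * B (e i) (e i) = ‖x‖ ^ 2 * lap n f.1 x := by
    rw [Finset.sum_comm, s1]
  have s4 : ∑ j, x j * D (e j) = D x := by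
    conv_rhs => rw [← hxe]
    simp
  simp only [Lam, Fintype.sum_prod_type, SetLike.val_smul, Pi.smul_apply, smul_eq_mul,
    AddSubmonoidClass.coe_finsetSum, Finset.sum_apply, hterm]
  have s5 : ∑ i, ∑ j, 2 * (x i * x j * B (e i) (e j)) = 2 * B x x := by
    simp only [← s2, Finset.mul_sum]
  have s6 : ∑ j, (n : ℝ) * (x j * D (e j)) = n * D x := by rw [← Finset.mul_sum, s4]
  simp only [Finset.sum_add_distrib, Finset.sum_sub_distrib, s1, s3, s4, s5, s6,
    Finset.sum_const, Finset.card_univ, Fintype.card_fin, ite_mul, zero_mul, Finset.sum_ite_eq,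
    Finset.mem_univ, if_true, nsmul_eq_mul]
  ring

/-- The Laplacian as an operator on functions smooth away from the origin. -/
noncomputable def lapOff (f : smoothOff (EuclideanSpace ℝ (Fin n))) :
    smoothOff (EuclideanSpace ℝ (Fin n)) :=
  normPow (-2) * (euler n (euler n f) + ((n : ℝ) - 2) • euler n f + Lam rot f)

lemma lap_eq (f : smoothOff (EuclideanSpace ℝ (Fin n))) {x : EuclideanSpace ℝ (Fin n)}
    (hx : x ≠ 0) : lap n f.1 x = (lapOff f).1 x := by
  have hx' := norm_pos_iff.2 hx
  have h1 := Lam_rot_apply f hx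
  have h2 : (euler n (euler n f)).1 x = fderiv ℝ (fderiv ℝ f.1) x x x + fderiv ℝ f.1 x x :=
    linDer_linDer_apply _ _ f hx
  have h3 : (euler n f).1 x = fderiv ℝ f.1 x x := rfl
  simp only [lapOff, MulMemClass.coe_mul, Pi.mul_apply, normPow_apply _ hx, AddMemClass.coe_add,
    Pi.add_apply, SetLike.val_smul, Pi.smul_apply, smul_eq_mul, h1, h2, h3]
  rw [Real.rpow_neg hx'.le, Real.rpow_two]
  field_simp
  ring

lemma lap_congr {u v : EuclideanSpace ℝ (Fin n) → ℝ} {x : EuclideanSpace ℝ (Fin n)}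
    (h : u =ᶠ[𝓝 x] v) : lap n u x = lap n v x := by
  simp only [lap, (h.iteratedFDeriv ℝ 2).eq_of_nhds]

lemma lap_eq_of_eq {u : EuclideanSpace ℝ (Fin n) → ℝ}
    {f : smoothOff (EuclideanSpace ℝ (Fin n))} (h : ∀ x ≠ 0, u x = f.1 x)
    {x : EuclideanSpace ℝ (Fin n)} (hx : x ≠ 0) : lap n u x = (lapOff f).1 x := by
  rw [← lap_eq f hx]
  refine lap_congr ?_
  filter_upwards [isOpen_ne.mem_nhds hx] with y hy using h y hy

lemma rot_rad {φ : ℝ → ℝ} (hφ : ContDiff ℝ (⊤ : ℕ∞) φ) (k : Fin n × Fin n) :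
    rot k (rad hφ) = 0 :=
  linDer_rad_eq_zero hφ (inner_rotMap k)

lemma rot_normPow (s : ℝ) (k : Fin n × Fin n) : rot k (normPow s) = 0 :=
  rot_rad _ k

lemma euler_normPow (s : ℝ) : euler n (normPow s) = s • normPow s := linDer_id_normPow s

lemma derivation_twice_mul {R : Type*} [CommRing R] [Algebra ℝ R] {E : Derivation ℝ R R} {ρ : R}
    {s : ℝ} (h : E ρ = s • ρ) (f : R) :
    E (E (ρ * f)) = ρ * (E (E f) + (2 * s) • E f + (s * s) • f) := by
  simp only [Derivation.leibniz, h, smul_eq_mul, Derivation.map_smul, map_add]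
  simp only [Algebra.smul_def, map_mul, map_ofNat]
  ring

lemma lapOff_normPow_mul (s : ℝ) (f : smoothOff (EuclideanSpace ℝ (Fin n))) :
    lapOff (normPow s * f) = normPow (s - 2) * (euler n (euler n f)
      + ((n : ℝ) - 2 + 2 * s) • euler n f + (s * (s + n - 2)) • f + Lam rot f) := by
  have hr : ∀ k, rot k (normPow s : smoothOff (EuclideanSpace ℝ (Fin n))) = 0 := rot_normPow s
  have he : euler n (normPow s) = s • normPow s := euler_normPow s
  have hL := Lam_mul hr f
  have hE := derivation_twice_mul he f
  have hE' := (euler n).leibniz (normPow s) f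
  rw [he] at hE'
  rw [lapOff, hL, hE, hE', sub_eq_neg_add s, ← normPow_mul (-2) s, mul_assoc]
  congr 1
  rw [show s * (s + n - 2) = s * s + (n - 2) * s by ring]
  simp only [smul_eq_mul, smul_add, add_smul, mul_add, mul_smul_comm, smul_mul_assoc,
    smul_smul, mul_comm f]
  abel

end Laplacian

section Integration

open scoped ContDiff

variable {n : ℕ}

lemma integral_fderiv_linear {F : EuclideanSpace ℝ (Fin n) → ℝ} (hF : ContDiff ℝ 1 F)
    (hc : HasCompactSupport F)
    (A : EuclideanSpace ℝ (Fin n) →L[ℝ] EuclideanSpace ℝ (Fin n)) :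
    ∫ x, fderiv ℝ F x (A x) = -((∑ i, A (EuclideanSpace.single i 1) i) * ∫ x, F x) := by
  have hA : ∀ i, Continuous fun x => (A x) i := fun i => by fun_prop
  have hFd : ∀ v, Continuous fun x => fderiv ℝ F x v := fun v =>
    (hF.continuous_fderiv (by simp)).clm_apply continuous_const
  have hFc : ∀ v, HasCompactSupport fun x => fderiv ℝ F x v := fun v =>
    hc.fderiv_apply (𝕜 := ℝ) v
  have hint : ∀ i, Integrable fun x => (A x) i * fderiv ℝ F x (EuclideanSpace.single i 1) :=
    fun i => ((hA i).mul (hFd _)).integrable_of_hasCompactSupport ((hFc _).mul_left)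
  have hi : ∀ i, ∫ x, (A x) i * fderiv ℝ F x (EuclideanSpace.single i 1) =
      -(A (EuclideanSpace.single i 1) i * ∫ x, F x) := by
    intro i
    have hL : ∀ x v, fderiv ℝ (fun x => (A x) i) x v = (A v) i := fun x v => by
      have : HasFDerivAt (fun x => (A x) i) ((EuclideanSpace.proj i : _ →L[ℝ] ℝ).comp A) x :=
        ((EuclideanSpace.proj i : _ →L[ℝ] ℝ).comp A).hasFDerivAt
      rw [this.fderiv]
      rfl
    rw [integral_mul_fderiv_eq_neg_fderiv_mul_of_integrable]
    · simp only [hL, integral_const_mul]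
    · simp only [hL]
      exact (hF.continuous.integrable_of_hasCompactSupport hc).const_mul _
    · exact hint i
    · exact ((hA i).mul hF.continuous).integrable_of_hasCompactSupport hc.mul_left
    · exact fun x _ => ((EuclideanSpace.proj i : _ →L[ℝ] ℝ).comp A).differentiableAt
    · exact fun x _ => hF.differentiable (by simp) x
  have hx : ∀ x, fderiv ℝ F x (A x) =
      ∑ i, (A x) i * fderiv ℝ F x (EuclideanSpace.single i 1) := fun x => by
    conv_lhs => rw [← sum_smul_single (A x)]
    simp
  simp only [hx]
  rw [integral_finsetSum _ fun i _ => hint i, Finset.sum_mul, ← Finset.sum_neg_distrib]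
  exact Finset.sum_congr rfl fun i _ => hi i

/-- Functions vanishing outside `K`, except possibly at the origin. -/
def suppIdeal (K : Set (EuclideanSpace ℝ (Fin n))) :
    Ideal (smoothOff (EuclideanSpace ℝ (Fin n))) where
  carrier := {f | ∀ x ≠ 0, x ∉ K → f.1 x = 0}
  add_mem' hf hg x hx hK := by simp [hf x hx hK, hg x hx hK]
  zero_mem' _ _ _ := rfl
  smul_mem' _ _ hf x hx hK := by simp [hf x hx hK]

lemma linDer_mem_suppIdeal {K : Set (EuclideanSpace ℝ (Fin n))} (hK : IsClosed K)
    (A : EuclideanSpace ℝ (Fin n) →L[ℝ] EuclideanSpace ℝ (Fin n))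
    {f : smoothOff (EuclideanSpace ℝ (Fin n))} (hf : f ∈ suppIdeal K) :
    linDer A f ∈ suppIdeal K := by
  intro x hx hxK
  have : f.1 =ᶠ[𝓝 x] fun _ => 0 := by
    filter_upwards [isOpen_ne.mem_nhds hx, hK.isOpen_compl.mem_nhds hxK] with y hy hyK
    exact hf y hy hyK
  rw [linDer_apply, this.fderiv_eq]
  simp

lemma continuousOn_of_zero_notMem (f : smoothOff (EuclideanSpace ℝ (Fin n)))
    {K : Set (EuclideanSpace ℝ (Fin n))} (h0 : 0 ∉ K) : ContinuousOn f.1 K := fun _ hx =>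
  (smoothOff_contDiffAt f (fun h => h0 (h ▸ hx))).continuousAt.continuousWithinAt

lemma integrableOn_of_zero_notMem (f : smoothOff (EuclideanSpace ℝ (Fin n)))
    {K : Set (EuclideanSpace ℝ (Fin n))} (hK : IsCompact K) (h0 : 0 ∉ K) :
    IntegrableOn f.1 K :=
  (continuousOn_of_zero_notMem f h0).integrableOn_compact hK

/-- Integration over `K` against the dilation-invariant measure `‖x‖ ^ (-n) dx`. -/
noncomputable def cylInt {K : Set (EuclideanSpace ℝ (Fin n))} (hK : IsCompact K) (h0 : 0 ∉ K) :
    smoothOff (EuclideanSpace ℝ (Fin n)) →ₗ[ℝ] ℝ where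
  toFun f := ∫ x in K, (normPow (-n) * f).1 x
  map_add' f g := by
    rw [mul_add]
    exact integral_add (integrableOn_of_zero_notMem _ hK h0) (integrableOn_of_zero_notMem _ hK h0)
  map_smul' c f := by
    rw [mul_smul_comm]
    exact integral_const_mul c _

lemma cylInt_apply {K : Set (EuclideanSpace ℝ (Fin n))} (hK : IsCompact K) (h0 : 0 ∉ K)
    (f : smoothOff (EuclideanSpace ℝ (Fin n))) :
    cylInt hK h0 f = ∫ x in K, (normPow (-n) * f).1 x := rfl

lemma posOn_cylInt {K : Set (EuclideanSpace ℝ (Fin n))} (hK : IsCompact K) (h0 : 0 ∉ K) :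
    PosOn (cylInt hK h0) {0}ᶜ := by
  intro f hf
  refine setIntegral_nonneg hK.measurableSet fun x hx => ?_
  have hx0 : x ≠ 0 := fun h => h0 (h ▸ hx)
  have := normPow_apply (-(n : ℝ)) hx0
  rw [MulMemClass.coe_mul, Pi.mul_apply, this]
  exact mul_nonneg (by positivity) (hf x hx0)

open Classical in
lemma setIntegral_linDer {K : Set (EuclideanSpace ℝ (Fin n))} (hK : IsCompact K) (h0 : 0 ∉ K)
    {f : smoothOff (EuclideanSpace ℝ (Fin n))} (hf : f ∈ suppIdeal K)
    (A : EuclideanSpace ℝ (Fin n) →L[ℝ] EuclideanSpace ℝ (Fin n)) :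
    ∫ x in K, (linDer A f).1 x = -((∑ i, A (EuclideanSpace.single i 1) i) * ∫ x in K, f.1 x) := by
  obtain ⟨F, hF⟩ : ∃ F : EuclideanSpace ℝ (Fin n) → ℝ, F = K.indicator f.1 := ⟨_, rfl⟩
  have hFf : ∀ x ≠ 0, F =ᶠ[𝓝 x] f.1 := fun x hx => by
    filter_upwards [isOpen_ne.mem_nhds hx] with y hy
    by_cases hyK : y ∈ K
    · simp [hF, hyK]
    · simp [hF, hyK, hf y hy hyK]
  have hF0 : ∀ x ∉ K, F =ᶠ[𝓝 x] fun _ => 0 := fun x hx => by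
    filter_upwards [hK.isClosed.isOpen_compl.mem_nhds hx] with y hy
    simp [hF, show y ∉ K from hy]
  have hFc : ContDiff ℝ 1 F := contDiff_iff_contDiffAt.2 fun x => by
    rcases eq_or_ne x 0 with rfl | hx
    · exact contDiffAt_const.congr_of_eventuallyEq (hF0 0 h0)
    · exact ((smoothOff_contDiffAt f hx).congr_of_eventuallyEq (hFf x hx)).of_le (by simp)
  have hFs : HasCompactSupport F := by
    rw [hF]
    exact HasCompactSupport.intro hK fun x hx => indicator_of_notMem hx _
  have := integral_fderiv_linear hFc hFs A
  have e1 : (fun x => fderiv ℝ F x (A x)) = K.indicator (linDer A f).1 := by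
    ext x
    by_cases hx : x ∈ K
    · have hx0 : x ≠ 0 := fun h => h0 (h ▸ hx)
      rw [indicator_of_mem hx, linDer_apply, (hFf x hx0).fderiv_eq]
    · rw [indicator_of_notMem hx, (hF0 x hx).fderiv_eq]
      simp
  rw [e1, hF, integral_indicator hK.measurableSet, integral_indicator hK.measurableSet] at this
  exact this

lemma setting_cylInt {K : Set (EuclideanSpace ℝ (Fin n))} (hK : IsCompact K) (h0 : 0 ∉ K) :
    Setting (euler n) rot (cylInt hK h0) (suppIdeal K) where
  comm := euler_rot
  stable f hf := linDer_mem_suppIdeal hK.isClosed _ hf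
  stable' k f hf := linDer_mem_suppIdeal hK.isClosed _ hf
  radial f hf := by
    have hm : normPow (-n) * f ∈ suppIdeal K := Ideal.mul_mem_left _ _ hf
    have h1 : ∫ x in K, (euler n (normPow (-n) * f)).1 x = _ := setIntegral_linDer hK h0 hm _
    have he : euler n (normPow (-n)) = (-(n : ℝ)) • normPow (-n) := euler_normPow _
    have h2 : euler n (normPow (-n) * f) =
        normPow (-n) * euler n f + (-(n : ℝ)) • (normPow (-n) * f) := by
      rw [Derivation.leibniz, he, smul_eq_mul, smul_eq_mul, mul_smul_comm, mul_comm f]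
    have h3 : ∫ x in K, (euler n (normPow (-n) * f)).1 x =
        cylInt hK h0 (euler n f) + (-(n : ℝ)) * cylInt hK h0 f := by
      rw [h2]
      exact (integral_add (integrableOn_of_zero_notMem _ hK h0)
        (integrableOn_of_zero_notMem _ hK h0)).trans (congrArg _ (integral_const_mul _ _))
    rw [h3, ← cylInt_apply hK h0] at h1
    simp at h1
    exact h1
  tangential k f hf := by
    have hm : normPow (-n) * f ∈ suppIdeal K := Ideal.mul_mem_left _ _ hf
    have h1 : ∫ x in K, (rot k (normPow (-n) * f)).1 x = _ := setIntegral_linDer hK h0 hm _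
    have he : rot k (normPow (-n) : smoothOff (EuclideanSpace ℝ (Fin n))) = 0 := rot_normPow _ k
    have h2 : rot k (normPow (-n) * f) = normPow (-n) * rot k f := by
      rw [Derivation.leibniz, he, smul_zero, add_zero, smul_eq_mul]
    have h3 : ∑ i, rotMap k (EuclideanSpace.single i 1) i = 0 := Finset.sum_eq_zero fun l _ => by
      simpa [EuclideanSpace.inner_single_left] using inner_rotMap k (EuclideanSpace.single l 1)
    rw [h2, h3] at h1
    rw [cylInt_apply, h1]
    simp

end Integration

section Cutoffs

open scoped ContDiff

variable {n : ℕ}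

/-- A smooth function with values in `[0, 1]`, equal to one on `[-1, 1]` and to zero outside
`[-2, 2]`. -/
structure Profile (χ : ℝ → ℝ) : Prop where
  smooth : ContDiff ℝ ∞ χ
  nonneg : ∀ t, 0 ≤ χ t
  le_one : ∀ t, χ t ≤ 1
  eq_one : ∀ t, |t| ≤ 1 → χ t = 1
  eq_zero : ∀ t, 2 ≤ |t| → χ t = 0

lemma exists_profile : ∃ χ : ℝ → ℝ, Profile χ := by
  let χ : ContDiffBump (0 : ℝ) := ⟨1, 2, one_pos, one_lt_two⟩
  exact ⟨χ, χ.contDiff, fun t => χ.nonneg, fun t => χ.le_one,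
    fun t ht => χ.one_of_mem_closedBall (by simpa using ht),
    fun t ht => χ.zero_of_le_dist (by simpa using ht)⟩

variable {χ : ℝ → ℝ}

lemma Profile.iteratedDeriv_pow (hχ : Profile χ) (k j : ℕ) (hj : j ≤ k) :
    ∃ b : ℝ → ℝ, ContDiff ℝ ∞ b ∧
      iteratedDeriv j (fun t => χ t ^ k) = fun t => χ t ^ (k - j) * b t := by
  induction j with
  | zero => exact ⟨fun _ => 1, contDiff_const, by simp⟩
  | succ j ih =>
    obtain ⟨b, hb, h⟩ := ih (by omega)
    have hχ' : ContDiff ℝ ∞ (deriv χ) := (contDiff_infty_iff_deriv.1 hχ.smooth).2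
    have hb' : ContDiff ℝ ∞ (deriv b) := (contDiff_infty_iff_deriv.1 hb).2
    refine ⟨fun t => (k - j : ℕ) * deriv χ t * b t + χ t * deriv b t, ?_, ?_⟩
    · exact ((contDiff_const.mul hχ').mul hb).add (hχ.smooth.mul hb')
    · rw [iteratedDeriv_succ, h]
      ext t
      have h1 := ((hχ.smooth.differentiable (by simp) t).hasDerivAt.pow (k - j)).mul
        (hb.differentiable (by simp) t).hasDerivAt
      rw [show k - j = (k - (j + 1)) + 1 by omega] at h1 ⊢
      refine h1.deriv.trans ?_
      simp only [Nat.add_sub_cancel, Pi.pow_apply]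
      ring

lemma Profile.exists_bound (hχ : Profile χ) (j k : ℕ) (hj : j < k) :
    ∃ C : ℝ, 0 ≤ C ∧ ∀ t, |iteratedDeriv j (fun t => χ t ^ k) t| ≤ C * χ t ^ (k - j) := by
  obtain ⟨b, hb, h⟩ := hχ.iteratedDeriv_pow k j hj.le
  obtain ⟨C, hC⟩ := (isCompact_Icc (a := (-2 : ℝ)) (b := 2)).exists_bound_of_continuousOn
    hb.continuous.continuousOn
  refine ⟨|C|, abs_nonneg _, fun t => ?_⟩
  rw [h]
  rcases le_total 2 |t| with ht | ht
  · simp [hχ.eq_zero t ht, (Nat.sub_pos_of_lt hj).ne']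
  · rw [abs_mul, abs_of_nonneg (pow_nonneg (hχ.nonneg t) _), mul_comm]
    exact mul_le_mul_of_nonneg_right ((hC t (abs_le.1 ht)).trans (le_abs_self C))
      (pow_nonneg (hχ.nonneg t) _)

lemma Profile.contDiff_scale_pow (hχ : Profile χ) (L : ℝ) (k : ℕ) :
    ContDiff ℝ ∞ fun t => χ (L⁻¹ * t) ^ k :=
  (hχ.smooth.comp (contDiff_const.mul contDiff_id)).pow k

lemma Profile.exists_bound_scale (hχ : Profile χ) (j k : ℕ) (hj : j < k) (hj0 : j ≠ 0) :
    ∃ C : ℝ, 0 ≤ C ∧ ∀ L : ℝ, 1 ≤ L → ∀ t,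
      |iteratedDeriv j (fun t => χ (L⁻¹ * t) ^ k) t| ≤ C / L * χ (L⁻¹ * t) ^ (k - j) := by
  obtain ⟨C, hC0, hC⟩ := hχ.exists_bound j k hj
  refine ⟨C, hC0, fun L hL t => ?_⟩
  have hL0 : 0 < L := by linarith
  have hs : ContDiff ℝ j fun t => χ t ^ k := (hχ.smooth.pow k).of_le (by exact_mod_cast le_top)
  rw [iteratedDeriv_comp_const_mul hs L⁻¹, abs_mul, abs_of_nonneg (by positivity)]
  have h1 : L⁻¹ ^ j ≤ L⁻¹ := pow_le_of_le_one (by positivity) (inv_le_one_of_one_le₀ hL) hj0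
  calc L⁻¹ ^ j * |iteratedDeriv j (fun t => χ t ^ k) (L⁻¹ * t)|
      ≤ L⁻¹ * (C * χ (L⁻¹ * t) ^ (k - j)) :=
        mul_le_mul h1 (hC _) (abs_nonneg _) (by positivity)
    _ = C / L * χ (L⁻¹ * t) ^ (k - j) := by ring

lemma iterate_euler_rad (j : ℕ) {φ : ℝ → ℝ} (hφ : ContDiff ℝ ∞ φ)
    {x : EuclideanSpace ℝ (Fin n)} (hx : x ≠ 0) :
    ((euler n)^[j] (rad hφ)).1 x = iteratedDeriv j φ (Real.log ‖x‖) := by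
  induction j generalizing φ with
  | zero => simpa using rad_apply hφ hx
  | succ j ih =>
    have hφ' := contDiff_infty_iff_deriv.1 hφ
    have h : euler n (rad hφ) = rad hφ'.2 :=
      linDer_id_rad hφ hφ'.2 fun t => (hφ'.1 t).hasDerivAt
    rw [Function.iterate_succ_apply, h, ih, iteratedDeriv_succ']

/-- The `k`-th power of the radial cutoff at logarithmic scale `L`. -/
noncomputable def radCut (hχ : Profile χ) (L : ℝ) (k : ℕ) :
    smoothOff (EuclideanSpace ℝ (Fin n)) :=
  rad (hχ.contDiff_scale_pow L k)

lemma radCut_apply (hχ : Profile χ) (L : ℝ) (k : ℕ) {x : EuclideanSpace ℝ (Fin n)}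
    (hx : x ≠ 0) : (radCut hχ L k).1 x = χ (L⁻¹ * Real.log ‖x‖) ^ k :=
  rad_apply _ hx

lemma radCut_sq (hχ : Profile χ) (L : ℝ) (k : ℕ) :
    (radCut hχ L k : smoothOff (EuclideanSpace ℝ (Fin n))) ^ 2 = radCut hχ L (2 * k) := by
  ext x
  rcases eq_or_ne x 0 with rfl | hx
  · simp [radCut, rad_zero]
  · have h1 := radCut_apply hχ L k hx
    have h2 := radCut_apply hχ L (2 * k) hx
    rw [h2, SubmonoidClass.coe_pow, Pi.pow_apply, h1, ← pow_mul, mul_comm k]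

/-- The closed spherical shell `-L ≤ log ‖x‖ ≤ L`. -/
def shell (n : ℕ) (L : ℝ) : Set (EuclideanSpace ℝ (Fin n)) :=
  closedBall 0 (Real.exp L) \ ball 0 (Real.exp (-L))

lemma isCompact_shell (L : ℝ) : IsCompact (shell n L) :=
  (isCompact_closedBall _ _).diff isOpen_ball

lemma zero_notMem_shell (L : ℝ) : 0 ∉ shell n L := fun h =>
  h.2 (mem_ball_self (Real.exp_pos _))

lemma mem_shell {L : ℝ} {x : EuclideanSpace ℝ (Fin n)} (hx : x ≠ 0) :
    x ∈ shell n L ↔ |Real.log ‖x‖| ≤ L := by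
  have hx' := norm_pos_iff.2 hx
  rw [shell, Set.mem_sdiff, mem_closedBall_zero_iff, mem_ball_zero_iff, not_lt, abs_le,
    ← Real.log_le_iff_le_exp hx', ← Real.le_log_iff_exp_le hx', and_comm]

lemma radCut_mem (hχ : Profile χ) {L M : ℝ} (hL : 0 < L) (hM : 2 * L ≤ M) {k : ℕ} (hk : k ≠ 0) :
    radCut hχ L k ∈ suppIdeal (shell n M) := by
  intro x hx hxM
  rw [mem_shell hx, not_le] at hxM
  rw [radCut_apply hχ L k hx, hχ.eq_zero, zero_pow hk]
  rw [abs_mul, abs_of_pos (inv_pos.2 hL), le_inv_mul_iff₀ hL]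
  linarith

lemma rot_radCut (hχ : Profile χ) (L : ℝ) (k : ℕ) (l : Fin n × Fin n) :
    rot l (radCut hχ L k) = 0 :=
  rot_rad _ l

lemma Profile.exists_cutoff (hχ : Profile χ) (n m : ℕ) (hm : 5 ≤ m) :
    ∃ c : ℝ, 0 ≤ c ∧ ∀ L M : ℝ, 1 ≤ L → 2 * L ≤ M →
      Cutoff (euler n) rot (suppIdeal (shell n M)) {0}ᶜ (c / L)
        (radCut hχ L m) (radCut hχ L (2 * m - 2)) (radCut hχ L (2 * m - 4)) := by
  obtain ⟨a1, ha1, A1⟩ := hχ.exists_bound_scale 1 (2 * m) (by omega) (by omega)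
  obtain ⟨a2, ha2, A2⟩ := hχ.exists_bound_scale 2 (2 * m) (by omega) (by omega)
  obtain ⟨a3, ha3, A3⟩ := hχ.exists_bound_scale 3 (2 * m) (by omega) (by omega)
  obtain ⟨a4, ha4, A4⟩ := hχ.exists_bound_scale 4 (2 * m) (by omega) (by omega)
  obtain ⟨b1, hb1, B1⟩ := hχ.exists_bound_scale 1 m (by omega) (by omega)
  obtain ⟨b2, hb2, B2⟩ := hχ.exists_bound_scale 2 m (by omega) (by omega)
  obtain ⟨b4, hb4, B4⟩ := hχ.exists_bound_scale 4 m (by omega) (by omega)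
  obtain ⟨d2, hd2, D2⟩ := hχ.exists_bound_scale 2 (2 * m - 2) (by omega) (by omega)
  obtain ⟨c, hc⟩ : ∃ c : ℝ, c = a1 + a2 + a3 + a4 + b1 ^ 2 + b2 + b4 + d2 := ⟨_, rfl⟩
  have hsq1 := sq_nonneg b1
  refine ⟨c, by rw [hc]; positivity, fun L M hL hM => ?_⟩
  have hL0 : 0 < L := by linarith
  have up : ∀ {t C T : ℝ} {i l : ℕ}, |T| ≤ C / L * χ t ^ i → l ≤ i → 0 ≤ C → C ≤ c →
      |T| ≤ c / L * χ t ^ l := fun {t C T i l} h hil hC0 hC =>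
    h.trans (mul_le_mul (by gcongr)
      (pow_le_pow_of_le_one (hχ.nonneg t) (hχ.le_one t) hil) (pow_nonneg (hχ.nonneg t) _)
      (by have := hC0.trans hC; positivity))
  have iter : ∀ (j k : ℕ) {x : EuclideanSpace ℝ (Fin n)}, x ≠ 0 →
      ((euler n)^[j] (radCut hχ L k)).1 x =
        iteratedDeriv j (fun t => χ (L⁻¹ * t) ^ k) (Real.log ‖x‖) :=
    fun j k x hx => iterate_euler_rad j (hχ.contDiff_scale_pow L k) hx
  constructor
  · exact radCut_mem hχ hL0 hM (by omega)
  · exact radCut_mem hχ hL0 hM (by omega)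
  · exact rot_radCut hχ L m
  · exact rot_radCut hχ L _
  · intro x hx
    rw [radCut_apply hχ L _ hx, radCut_apply hχ L _ hx, ← pow_mul]
    exact pow_le_pow_of_le_one (hχ.nonneg _) (hχ.le_one _) (by omega)
  · intro x hx
    rw [radCut_apply hχ L _ hx, radCut_apply hχ L _ hx]
    exact pow_le_pow_of_le_one (hχ.nonneg _) (hχ.le_one _) (by omega)
  · intro x hx
    rw [radCut_apply hχ L _ hx, radCut_apply hχ L _ hx, radCut_apply hχ L _ hx, ← pow_mul,
      ← pow_mul, ← pow_add]
    congr 1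
    omega
  · intro x hx
    rw [radCut_sq, radCut_apply hχ L _ hx]
    refine up ?_ (i := 2 * m - 1) (by omega) ha1 (by rw [hc]; linarith)
    have := A1 L hL (Real.log ‖x‖)
    rwa [← iter 1 _ hx] at this
  · intro x hx
    rw [radCut_sq, radCut_apply hχ L _ hx]
    refine up ?_ (i := 2 * m - 2) (by omega) ha2 (by rw [hc]; linarith)
    have := A2 L hL (Real.log ‖x‖)
    rwa [← iter 2 _ hx] at this
  · intro x hx
    rw [radCut_sq, radCut_apply hχ L _ hx]
    refine up ?_ (i := 2 * m - 3) (by omega) ha3 (by rw [hc]; linarith)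
    have := A3 L hL (Real.log ‖x‖)
    rwa [← iter 3 _ hx] at this
  · intro x hx
    rw [radCut_sq, radCut_apply hχ L _ hx]
    refine up ?_ (i := 2 * m - 4) (by omega) ha4 (by rw [hc]; linarith)
    have := A4 L hL (Real.log ‖x‖)
    rwa [← iter 4 _ hx] at this
  · intro x hx
    rw [radCut_apply hχ L _ hx]
    refine up (C := b1 ^ 2) ?_ (i := 2 * m - 2) (by omega) hsq1 (by rw [hc]; linarith)
    have := B1 L hL (Real.log ‖x‖)
    rw [← iter 1 _ hx] at this
    have e : (euler n (radCut hχ L m) ^ 2).1 x = ((euler n)^[1] (radCut hχ L m)).1 x ^ 2 := rfl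
    have hLL : 1 / L ^ 2 ≤ 1 / L :=
      one_div_le_one_div_of_le hL0 (by nlinarith)
    rw [e, abs_pow]
    calc _ ≤ (b1 / L * χ (L⁻¹ * Real.log ‖x‖) ^ (m - 1)) ^ 2 :=
          pow_le_pow_left₀ (abs_nonneg _) this 2
      _ = b1 ^ 2 * (1 / L ^ 2) * χ (L⁻¹ * Real.log ‖x‖) ^ (2 * m - 2) := by
          rw [mul_pow, ← pow_mul, show (m - 1) * 2 = 2 * m - 2 by omega]
          ring
      _ ≤ b1 ^ 2 * (1 / L) * χ (L⁻¹ * Real.log ‖x‖) ^ (2 * m - 2) :=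
          mul_le_mul_of_nonneg_right (mul_le_mul_of_nonneg_left hLL hsq1)
            (pow_nonneg (hχ.nonneg _) _)
      _ = _ := by ring
  · intro x hx
    rw [radCut_apply hχ L _ hx]
    refine up (C := b2) ?_ (i := 2 * m - 2) (by omega) hb2 (by rw [hc]; linarith)
    have := B2 L hL (Real.log ‖x‖)
    rw [← iter 2 _ hx] at this
    have e : (radCut hχ L m * euler n (euler n (radCut hχ L m))).1 x =
      (radCut hχ L m).1 x * ((euler n)^[2] (radCut hχ L m)).1 x := rfl
    rw [e, radCut_apply hχ L _ hx, abs_mul, abs_of_nonneg (pow_nonneg (hχ.nonneg _) _)]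
    refine (mul_le_mul_of_nonneg_left this (pow_nonneg (hχ.nonneg _) _)).trans (le_of_eq ?_)
    rw [show 2 * m - 2 = m + (m - 2) by omega, pow_add]
    ring
  · intro x hx
    rw [radCut_apply hχ L _ hx]
    refine up (C := b4) ?_ (i := 2 * m - 4) (by omega) hb4 (by rw [hc]; linarith)
    have := B4 L hL (Real.log ‖x‖)
    rw [← iter 4 _ hx] at this
    have e : (radCut hχ L m * euler n (euler n (euler n (euler n (radCut hχ L m))))).1 x =
      (radCut hχ L m).1 x * ((euler n)^[4] (radCut hχ L m)).1 x := rfl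
    rw [e, radCut_apply hχ L _ hx, abs_mul, abs_of_nonneg (pow_nonneg (hχ.nonneg _) _)]
    refine (mul_le_mul_of_nonneg_left this (pow_nonneg (hχ.nonneg _) _)).trans (le_of_eq ?_)
    rw [show 2 * m - 4 = m + (m - 4) by omega, pow_add]
    ring
  · intro x hx
    rw [radCut_apply hχ L _ hx]
    refine up (C := d2) ?_ (i := 2 * m - 2 - 2) (by omega) hd2 (by rw [hc]; linarith)
    have := D2 L hL (Real.log ‖x‖)
    rwa [← iter 2 _ hx] at this

/-- The volume of a shell for the dilation-invariant measure grows linearly. -/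
lemma cylInt_one_le (n : ℕ) (hn : n ≠ 0) : ∃ C : ℝ, 0 ≤ C ∧ ∀ L : ℝ, 0 ≤ L →
    cylInt (isCompact_shell L) (zero_notMem_shell (n := n) L) 1 ≤ C * L := by
  refine ⟨n * volume.real (ball (0 : EuclideanSpace ℝ (Fin n)) 1) * 2, by positivity,
    fun L hL => le_of_eq ?_⟩
  have : Nonempty (Fin n) := ⟨⟨0, by omega⟩⟩
  have hS := isCompact_shell (n := n) L
  have e : (shell n L).indicator (normPow (-n) * 1 : smoothOff (EuclideanSpace ℝ (Fin n))).1 =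
      fun x => (Icc (Real.exp (-L)) (Real.exp L)).indicator (fun t => t ^ (-(n : ℝ))) ‖x‖ := by
    ext x
    by_cases hx : x ∈ shell n L
    · have hx0 : x ≠ 0 := fun h => zero_notMem_shell L (h ▸ hx)
      rw [indicator_of_mem hx, mul_one, normPow_apply _ hx0, indicator_of_mem]
      simpa [shell, and_comm] using hx
    · rw [indicator_of_notMem hx, indicator_of_notMem]
      intro h
      exact hx (by simpa [shell, and_comm] using h)
  rw [cylInt_apply, ← integral_indicator hS.measurableSet, e, integral_fun_norm_addHaar volume,
    finrank_euclideanSpace_fin]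
  have hsub : Icc (Real.exp (-L)) (Real.exp L) ⊆ Ioi 0 := fun t ht => (Real.exp_pos _).trans_le ht.1
  have e2 : ∀ y : ℝ, y ^ (n - 1) •
      (Icc (Real.exp (-L)) (Real.exp L)).indicator (fun t : ℝ => t ^ (-(n : ℝ))) y =
      (Icc (Real.exp (-L)) (Real.exp L)).indicator (fun t : ℝ => t⁻¹) y := by
    intro y
    by_cases hy : y ∈ Icc (Real.exp (-L)) (Real.exp L)
    · have hy0 : 0 < y := hsub hy
      rw [indicator_of_mem hy, indicator_of_mem hy, Real.rpow_neg hy0.le, Real.rpow_natCast,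
        smul_eq_mul]
      obtain ⟨k, rfl⟩ := Nat.exists_eq_succ_of_ne_zero hn
      simp only [Nat.succ_eq_add_one, Nat.add_sub_cancel, pow_succ]
      field_simp
    · simp [indicator_of_notMem hy]
  simp only [e2]
  rw [setIntegral_indicator measurableSet_Icc, inter_eq_right.2 hsub, integral_Icc_eq_integral_Ioc,
    ← intervalIntegral.integral_of_le (Real.exp_le_exp.2 (by linarith)),
    integral_inv_of_pos (Real.exp_pos _) (Real.exp_pos _), ← Real.exp_sub, Real.log_exp]
  simp only [nsmul_eq_mul, smul_eq_mul]
  ring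

end Cutoffs

section Equation

open scoped ContDiff

variable {n : ℕ}

lemma cylOp_eq_comp {R ι : Type*} [CommRing R] [Algebra ℝ R] [Fintype ι] {E : Derivation ℝ R R}
    {X : ι → Derivation ℝ R R} (hE : ∀ f, E (Lam X f) = Lam X (E f)) (b1 b2 k1 k2 : ℝ) (w w' : R)
    (hw : w' = E (E w) + b1 • E w + (-k1) • w + Lam X w) :
    E (E w') + b2 • E w' + (-k2) • w' + Lam X w' =
      cylOp E X (b1 + b2) (b1 * b2 - k1 - k2) (-k1 * b2 - k2 * b1) (k1 + k2) (k1 * k2) w := by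
  subst hw
  simp only [cylOp, map_add, Derivation.map_smul, Lam_add, Lam_smul, hE]
  module

lemma euler_Lam_rot (f : smoothOff (EuclideanSpace ℝ (Fin n))) :
    euler n (Lam rot f) = Lam rot (euler n f) :=
  (setting_cylInt (isCompact_shell 0) (zero_notMem_shell 0)).radial_Lam f

lemma lapOff_lapOff_normPow_mul (β k1 k2 : ℝ) (hk1 : k1 = β * (n - 2 - β))
    (hk2 : k2 = (β + 2) * (n - 4 - β)) (w : smoothOff (EuclideanSpace ℝ (Fin n))) :
    lapOff (lapOff (normPow (-β) * w)) = normPow (-β - 4) *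
      cylOp (euler n) rot (2 * n - 8 - 4 * β) ((n - 2 - 2 * β) * (n - 6 - 2 * β) - k1 - k2)
        (-k1 * (n - 6 - 2 * β) - k2 * (n - 2 - 2 * β)) (k1 + k2) (k1 * k2) w := by
  have hE : ∀ f : smoothOff (EuclideanSpace ℝ (Fin n)),
    euler n (Lam rot f) = Lam rot (euler n f) := euler_Lam_rot
  have h := cylOp_eq_comp hE (n - 2 - 2 * β) (n - 6 - 2 * β) k1 k2 w _ rfl
  rw [lapOff_normPow_mul, lapOff_normPow_mul, show -β - 2 - 2 = -β - 4 by ring,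
    show (2 * n - 8 - 4 * β : ℝ) = (n - 2 - 2 * β) + (n - 6 - 2 * β) by ring,
    show (n : ℝ) - 2 + 2 * -β = n - 2 - 2 * β by ring,
    show (n : ℝ) - 2 + 2 * (-β - 2) = n - 6 - 2 * β by ring,
    show -β * (-β + n - 2) = -k1 by rw [hk1]; ring,
    show (-β - 2) * (-β - 2 + n - 2) = -k2 by rw [hk2]; ring, h]

lemma lapOff_normPow_mul_eq_stabOp (f : smoothOff (EuclideanSpace ℝ (Fin n))) :
    lapOff (normPow (-((n - 4) / 2)) * f) =
      normPow (-(n / 2)) * stabOp (euler n) rot (n * (n - 4) / 4) f := by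
  rw [lapOff_normPow_mul, stabOp, show -(((n : ℝ) - 4) / 2) - 2 = -(n / 2) by ring,
    show (n : ℝ) - 2 + 2 * -((n - 4) / 2) = 2 by ring,
    show -(((n : ℝ) - 4) / 2) * (-((n - 4) / 2) + n - 2) = -(n * (n - 4) / 4) by ring, neg_smul,
    ← sub_eq_add_neg]

/-- A smooth function, as a function smooth away from the origin. -/
def ofSmooth {u : EuclideanSpace ℝ (Fin n) → ℝ} (hu : ContDiff ℝ (⊤ : ℕ∞) u) :
    smoothOff (EuclideanSpace ℝ (Fin n)) :=
  ⟨u, fun _ _ => hu.contDiffAt⟩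

/-- The Emden–Fowler transform `‖x‖ ^ β u` of `u`. -/
noncomputable def emden (β : ℝ) {u : EuclideanSpace ℝ (Fin n) → ℝ}
    (hu : ContDiff ℝ (⊤ : ℕ∞) u) : smoothOff (EuclideanSpace ℝ (Fin n)) :=
  normPow β * ofSmooth hu

variable {u : EuclideanSpace ℝ (Fin n) → ℝ}

lemma emden_apply (β : ℝ) (hu : ContDiff ℝ (⊤ : ℕ∞) u) {x : EuclideanSpace ℝ (Fin n)}
    (hx : x ≠ 0) : (emden β hu).1 x = ‖x‖ ^ β * u x :=
  congrArg (· * u x) (normPow_apply β hx)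

lemma eq_normPow_mul_emden (β : ℝ) (hu : ContDiff ℝ (⊤ : ℕ∞) u)
    {x : EuclideanSpace ℝ (Fin n)} (hx : x ≠ 0) : u x = (normPow (-β) * emden β hu).1 x := by
  have hx' := norm_pos_iff.2 hx
  have h := emden_apply β hu hx
  have h' := normPow_apply (-β) hx
  rw [MulMemClass.coe_mul, Pi.mul_apply, h, h', ← mul_assoc, ← Real.rpow_add hx',
    neg_add_cancel, Real.rpow_zero, one_mul]

lemma abs_rpow_eq_emden {p β : ℝ} (hu : ContDiff ℝ (⊤ : ℕ∞) u) {x : EuclideanSpace ℝ (Fin n)}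
    (hx : x ≠ 0) :
    |u x| ^ (p - 1) = ‖x‖ ^ (-(β * (p - 1))) * |(emden β hu).1 x| ^ (p - 1) := by
  have hx' := norm_pos_iff.2 hx
  rw [emden_apply β hu hx, abs_mul, Real.mul_rpow (abs_nonneg _) (abs_nonneg _),
    (abs_of_nonneg (Real.rpow_nonneg hx'.le β) : |‖x‖ ^ β| = ‖x‖ ^ β),
    ← Real.rpow_mul hx'.le, ← mul_assoc, ← Real.rpow_add hx',
    neg_add_cancel, Real.rpow_zero, one_mul]

lemma cylOp_emden {a p β k1 k2 : ℝ} (hβ : β * (p - 1) = 4 + a) (hk1 : k1 = β * (n - 2 - β))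
    (hk2 : k2 = (β + 2) * (n - 4 - β)) (hu : ContDiff ℝ (⊤ : ℕ∞) u)
    (hsol : IsSolutionOn n a p u univ) {x : EuclideanSpace ℝ (Fin n)} (hx : x ≠ 0) :
    (cylOp (euler n) rot (2 * n - 8 - 4 * β) ((n - 2 - 2 * β) * (n - 6 - 2 * β) - k1 - k2)
      (-k1 * (n - 6 - 2 * β) - k2 * (n - 2 - 2 * β)) (k1 + k2) (k1 * k2) (emden β hu)).1 x =
      |(emden β hu).1 x| ^ (p - 1) * (emden β hu).1 x := by
  have hx' := norm_pos_iff.2 hx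
  have h1 : lap n (lap n u) x = (lapOff (lapOff (normPow (-β) * emden β hu))).1 x :=
    lap_eq_of_eq (fun y hy => lap_eq_of_eq (fun z hz => eq_normPow_mul_emden β hu hz) hy) hx
  have h2 := normPow_apply (-β - 4) hx
  have h3 := normPow_apply (-β) hx
  have h4 := eq_normPow_mul_emden β hu hx
  rw [hsol x (mem_univ x), lapOff_lapOff_normPow_mul β k1 k2 hk1 hk2, MulMemClass.coe_mul,
    Pi.mul_apply, h2, abs_rpow_eq_emden (β := β) hu hx, hβ] at h1
  rw [MulMemClass.coe_mul, Pi.mul_apply, h3] at h4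
  rw [h4] at h1
  have h5 : ‖x‖ ^ (-β - 4) = ‖x‖ ^ a * ‖x‖ ^ (-(4 + a)) * ‖x‖ ^ (-β) := by
    rw [← Real.rpow_add hx', ← Real.rpow_add hx']
    congr 1
    ring
  refine mul_left_cancel₀ (Real.rpow_pos_of_pos hx' (-β - 4)).ne' ?_
  rw [← h1, h5]
  ring

lemma euler_mul_of_power {p : ℝ} (hp : 1 < p) {w g : smoothOff (EuclideanSpace ℝ (Fin n))}
    (hg : ∀ x ≠ 0, g.1 x = |w.1 x| ^ (p - 1) * w.1 x) :
    euler n (w * g) = (p + 1) • (g * euler n w) := by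
  ext x
  rcases eq_or_ne x 0 with rfl | hx
  · simp [euler, linDer_apply]
  · have h1 : (w * g).1 =ᶠ[𝓝 x] fun y => |w.1 y| ^ (p + 1) := by
      filter_upwards [isOpen_ne.mem_nhds hx] with y hy
      rw [MulMemClass.coe_mul, Pi.mul_apply, hg y hy]
      rcases eq_or_ne (w.1 y) 0 with h | h
      · simp [h, Real.zero_rpow (by linarith : p + 1 ≠ 0)]
      · rw [show p + 1 = (p - 1) + 2 by ring, Real.rpow_add (abs_pos.2 h), Real.rpow_two, sq_abs]
        ring
    have h2 : HasFDerivAt (fun y => |w.1 y| ^ (p + 1))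
        (((p + 1) * |w.1 x| ^ (p + 1 - 2) * w.1 x) • fderiv ℝ w.1 x) x :=
      (hasDerivAt_abs_rpow (w.1 x) (by linarith : 1 < p + 1)).comp_hasFDerivAt x
        (smoothOff_differentiableAt w hx).hasFDerivAt
    have h3 : (euler n (w * g)).1 x =
        ((p + 1) * |w.1 x| ^ (p + 1 - 2) * w.1 x) * (euler n w).1 x := by
      rw [euler, linDer_apply, h1.fderiv_eq, h2.fderiv]
      rfl
    rw [h3, show p + 1 - 2 = p - 1 by ring]
    simp only [SetLike.val_smul, Pi.smul_apply, MulMemClass.coe_mul, Pi.mul_apply, hg x hx,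
      smul_eq_mul]
    ring

lemma stable_emden {a p β M : ℝ} (hβ : β * (p - 1) = 4 + a) (hu : ContDiff ℝ (⊤ : ℕ∞) u)
    (hstab : StableOn n a p u univ) {g : smoothOff (EuclideanSpace ℝ (Fin n))}
    (hg : ∀ x ≠ 0, g.1 x = |(emden β hu).1 x| ^ (p - 1) * (emden β hu).1 x)
    {h : smoothOff (EuclideanSpace ℝ (Fin n))} (hh : h ∈ suppIdeal (shell n M)) :
    p * cylInt (isCompact_shell M) (zero_notMem_shell M) (h ^ 2 * (emden β hu * g)) ≤
      cylInt (isCompact_shell M) (zero_notMem_shell M)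
        (stabOp (euler n) rot (n * (n - 4) / 4) (h * emden β hu) ^ 2) := by
  set w := emden β hu with hw
  obtain ⟨f, hf⟩ : ∃ f : smoothOff (EuclideanSpace ℝ (Fin n)),
    f = normPow (-((n - 4) / 2)) * (h * w) := ⟨_, rfl⟩
  have hfI : f ∈ suppIdeal (shell n M) := by
    rw [hf]
    exact Ideal.mul_mem_left _ _ (Ideal.mul_mem_right _ _ hh)
  have hK := isCompact_shell (n := n) M
  have h0 := zero_notMem_shell (n := n) M
  have hf0 : ∀ x ∉ shell n M, f.1 x = 0 := fun x hx => by
    rcases eq_or_ne x 0 with rfl | hx0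
    · have : (normPow (-((n - 4) / 2))).1 (0 : EuclideanSpace ℝ (Fin n)) = 0 := rad_zero _
      rw [hf, MulMemClass.coe_mul, Pi.mul_apply, this, zero_mul]
    · exact hfI x hx0 hx
  have hloc : ∀ x ∉ shell n M, f.1 =ᶠ[𝓝 x] fun _ => 0 := fun x hx => by
    filter_upwards [hK.isClosed.isOpen_compl.mem_nhds hx] with y hy using hf0 y hy
  have hsm : ContDiff ℝ (⊤ : ℕ∞) f.1 := contDiff_iff_contDiffAt.2 fun x => by
    rcases eq_or_ne x 0 with rfl | hx
    · exact contDiffAt_const.congr_of_eventuallyEq (hloc 0 h0)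
    · exact smoothOff_contDiffAt f hx
  have key := hstab f.1 hsm (HasCompactSupport.intro hK hf0) (subset_univ _)
  have e1 : (fun x => ‖x‖ ^ a * |u x| ^ (p - 1) * f.1 x ^ 2) =
      (shell n M).indicator (normPow (-n) * (h ^ 2 * (w * g))).1 := by
    ext x
    by_cases hx : x ∈ shell n M
    · have hx0 : x ≠ 0 := fun h => h0 (h ▸ hx)
      have hx' := norm_pos_iff.2 hx0
      have n1 := normPow_apply (-(n : ℝ)) hx0
      have n2 := normPow_apply (-(((n : ℝ) - 4) / 2)) hx0
      rw [indicator_of_mem hx, abs_rpow_eq_emden (β := β) hu hx0, hβ, hf]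
      simp only [MulMemClass.coe_mul, Pi.mul_apply, SubmonoidClass.coe_pow, Pi.pow_apply, n1, n2,
        hg x hx0, ← hw]
      have h5 : ‖x‖ ^ (-(n : ℝ)) =
          ‖x‖ ^ a * ‖x‖ ^ (-(4 + a)) * (‖x‖ ^ (-(((n : ℝ) - 4) / 2))) ^ 2 := by
        rw [← Real.rpow_two, ← Real.rpow_mul hx'.le, ← Real.rpow_add hx', ← Real.rpow_add hx']
        congr 1
        ring
      rw [h5]
      ring
    · simp [indicator_of_notMem hx, hf0 x hx]
  have e2 : (fun x => lap n f.1 x ^ 2) = (shell n M).indicator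
      (normPow (-n) * stabOp (euler n) rot (n * (n - 4) / 4) (h * w) ^ 2).1 := by
    ext x
    by_cases hx : x ∈ shell n M
    · have hx0 : x ≠ 0 := fun h => h0 (h ▸ hx)
      have hx' := norm_pos_iff.2 hx0
      have n1 := normPow_apply (-(n : ℝ)) hx0
      have n2 := normPow_apply (-((n : ℝ) / 2)) hx0
      rw [indicator_of_mem hx, lap_eq f hx0, hf, lapOff_normPow_mul_eq_stabOp]
      simp only [MulMemClass.coe_mul, Pi.mul_apply, SubmonoidClass.coe_pow, Pi.pow_apply, n1, n2]
      rw [mul_pow, ← Real.rpow_two (‖x‖ ^ _), ← Real.rpow_mul hx'.le]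
      congr 2
      ring
    · have : lap n (fun _ : EuclideanSpace ℝ (Fin n) => (0 : ℝ)) x = 0 := by
        simp [lap]
      rw [indicator_of_notMem hx, lap_congr (hloc x hx), this]
      simp
  rw [e1, e2, integral_indicator hK.measurableSet, integral_indicator hK.measurableSet] at key
  exact key

end Equation

section Vanishing

open scoped ContDiff

variable {n : ℕ}

lemma young_cutoff {p T y ε : ℝ} {m : ℕ} (hp : 1 < p) (hT : 0 ≤ T) (hT' : T ≤ 1) (hy : 0 ≤ y)
    (hε : 0 < ε) (hm : 2 < m) (hmp : 4 ≤ ((m - 2 : ℕ) : ℝ) * (p - 1)) :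
    T ^ (2 * m - 4) * y ^ 2 ≤
      ε * (T ^ (2 * m) * (y ^ (p - 1) * y ^ 2)) + ((ε⁻¹) ^ (p - 1)⁻¹) ^ 2 := by
  have hp' : 0 < p - 1 := sub_pos.2 hp
  have hM : 0 ≤ (ε⁻¹) ^ (p - 1)⁻¹ := by positivity
  have hz : 0 ≤ T ^ (m - 2) * y := by positivity
  have e : T ^ (2 * m - 4) * y ^ 2 = (T ^ (m - 2) * y) ^ 2 := by
    rw [mul_pow, ← pow_mul]
    congr 2
    omega
  rw [e]
  rcases le_total (T ^ (m - 2) * y) ((ε⁻¹) ^ (p - 1)⁻¹) with h | h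
  · have : (T ^ (m - 2) * y) ^ 2 ≤ ((ε⁻¹) ^ (p - 1)⁻¹) ^ 2 := by gcongr
    have : 0 ≤ ε * (T ^ (2 * m) * (y ^ (p - 1) * y ^ 2)) := by positivity
    linarith
  · have h1 : ε⁻¹ ≤ (T ^ (m - 2) * y) ^ (p - 1) := by
      have := Real.rpow_le_rpow hM h hp'.le
      rwa [Real.rpow_inv_rpow (inv_nonneg.2 hε.le) hp'.ne'] at this
    have h2 : (T ^ (m - 2)) ^ (p - 1) ≤ T ^ 4 := by
      rw [← Real.rpow_natCast T (m - 2), ← Real.rpow_mul hT, ← Real.rpow_natCast T 4]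
      rcases hT.eq_or_lt with rfl | hT0
      · rw [Real.zero_rpow (by linarith)]
        positivity
      · exact Real.rpow_le_rpow_of_exponent_ge hT0 hT' (by exact_mod_cast hmp)
    rw [Real.mul_rpow (by positivity) hy] at h1
    have h3 : 1 ≤ ε * (T ^ 4 * y ^ (p - 1)) := by
      rw [← inv_le_iff_one_le_mul₀' hε]
      exact h1.trans (by gcongr)
    have h4 : ε * (T ^ (2 * m) * (y ^ (p - 1) * y ^ 2)) =
        (T ^ (m - 2) * y) ^ 2 * (ε * (T ^ 4 * y ^ (p - 1))) := by
      rw [mul_pow, ← pow_mul, show 2 * m = (m - 2) * 2 + 4 by omega, pow_add]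
      ring
    rw [h4]
    nlinarith [sq_nonneg (T ^ (m - 2) * y), sq_nonneg ((ε⁻¹) ^ (p - 1)⁻¹)]

/-- Decay of the weighted `L²` norm of the Emden–Fowler transform of a stable solution. -/
lemma exists_integral_shell_le {p c3 c2 c1 l1 l2 : ℝ} (hn : n ≠ 0) (hp : 1 < p) (hc3 : 0 ≤ c3)
    (hc1 : c1 < 0) (h1 : (n : ℝ) * (n - 4) / 2 < p * l1)
    (h2 : (n : ℝ) ^ 2 * (n - 4) ^ 2 / 16 < p * l2)
    {w g : smoothOff (EuclideanSpace ℝ (Fin n))}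
    (hg : g = cylOp (euler n) rot c3 c2 c1 l1 l2 w)
    (hgw : ∀ x ≠ 0, g.1 x = |w.1 x| ^ (p - 1) * w.1 x)
    (hst : ∀ (M : ℝ) (h : smoothOff (EuclideanSpace ℝ (Fin n))), h ∈ suppIdeal (shell n M) →
      p * cylInt (isCompact_shell M) (zero_notMem_shell M) (h ^ 2 * (w * g)) ≤
        cylInt (isCompact_shell M) (zero_notMem_shell M)
          (stabOp (euler n) rot (n * (n - 4) / 4) (h * w) ^ 2)) :
    ∃ C : ℝ, ∀ L, 1 ≤ L → ∫ x in shell n L, (normPow (-n) * w ^ 2).1 x ≤ C / L := by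
  obtain ⟨χ, hχ⟩ := exists_profile
  have hp' : 0 < p - 1 := sub_pos.2 hp
  obtain ⟨m, hm, hmp⟩ : ∃ m : ℕ, 5 ≤ m ∧ 4 ≤ ((m - 2 : ℕ) : ℝ) * (p - 1) := by
    obtain ⟨k, hk⟩ := exists_nat_ge (4 / (p - 1))
    refine ⟨k + 5, by omega, ?_⟩
    rw [div_le_iff₀ hp'] at hk
    push_cast [show k + 5 - 2 = k + 3 by omega]
    nlinarith
  obtain ⟨c, hc, hcut⟩ := hχ.exists_cutoff n m hm
  have hwg : ∀ x ∈ ({0}ᶜ : Set (EuclideanSpace ℝ (Fin n))), 0 ≤ (w * g).1 x := fun x hx => by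
    rw [MulMemClass.coe_mul, Pi.mul_apply, hgw x hx, mul_left_comm]
    exact mul_nonneg (Real.rpow_nonneg (abs_nonneg _) _) (mul_self_nonneg _)
  obtain ⟨K1, hK1⟩ := exists_full_le_of_young (κ := n * (n - 4) / 4) hp hc
    (fun ε => ((ε⁻¹) ^ (p - 1)⁻¹) ^ 2) hg hwg
  obtain ⟨K2, hK20, hK2⟩ := exists_full_le_of_pohozaev (κ := n * (n - 4) / 4) hp hc3 hc1
    (by linarith) (by linarith) hg hwg (euler_mul_of_power hp hgw)
  obtain ⟨C, hC, hJ1⟩ := cylInt_one_le n hn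
  refine ⟨K2 * c * (K2 * c * (|K1| * (C * 8))), fun L hL => ?_⟩
  have hL0 : 0 < L := by linarith
  set J := cylInt (isCompact_shell (n := n) (8 * L)) (zero_notMem_shell (8 * L)) with hJdef
  have hS : Setting (euler n) rot J (suppIdeal (shell n (8 * L))) := setting_cylInt _ _
  have hJ : PosOn J {0}ᶜ := posOn_cylInt _ _
  obtain ⟨F, hF⟩ : ∃ F : ℝ → ℝ, ∀ L', F L' = full (euler n) rot J (radCut hχ L' m ^ 2) w g :=
    ⟨_, fun _ => rfl⟩
  have hF4 : F (4 * L) ≤ |K1| * (C * (8 * L)) := by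
    have hC4 := hcut (4 * L) (8 * L) (by linarith) (by linarith)
    rw [hF]
    refine (hK1 J _ _ _ _ (c / (4 * L)) hS hJ (by positivity) (div_le_self hc (by linarith)) hC4
      (hst _ _ hC4.mem) fun ε hε x hx => ?_).trans ?_
    · have e1 := radCut_apply hχ (4 * L) m hx
      have e2 := radCut_apply hχ (4 * L) (2 * m - 4) hx
      have := young_cutoff hp (hχ.nonneg ((4 * L)⁻¹ * Real.log ‖x‖)) (hχ.le_one _)
        (abs_nonneg (w.1 x)) hε (by omega) hmp
      simp only [MulMemClass.coe_mul, Pi.mul_apply, SubmonoidClass.coe_pow, Pi.pow_apply, e1, e2,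
        hgw x hx]
      rw [sq_abs] at this
      convert this using 3
      rw [← pow_mul, mul_comm m 2]
      ring
    · have hJ0 : 0 ≤ J 1 := hJ 1 fun _ _ => zero_le_one
      exact (mul_le_mul_of_nonneg_right (le_abs_self K1) hJ0).trans
        (mul_le_mul_of_nonneg_left (hJ1 _ (by linarith)) (abs_nonneg _))
  have step : ∀ L', 1 ≤ L' → 2 * L' ≤ 8 * L → F L' ≤ K2 * (c / L' * F (2 * L')) := by
    intro L' hL' hL8
    have hL'0 : 0 < L' := by linarith
    have hCL := hcut L' (8 * L) hL' hL8
    rw [hF, hF]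
    refine hK2 J _ _ _ _ _ _ hS hJ (by positivity) hCL (hst _ _ hCL.mem) fun x hx => ?_
    have e1 := radCut_apply hχ (2 * L') m hx
    have e2 := radCut_apply hχ L' (2 * m - 4) hx
    rw [SubmonoidClass.coe_pow, Pi.pow_apply, e1, e2]
    rcases le_total 2 |L'⁻¹ * Real.log ‖x‖| with h | h
    · rw [hχ.eq_zero _ h, zero_pow (by omega)]
      positivity
    · rw [hχ.eq_one ((2 * L')⁻¹ * Real.log ‖x‖), one_pow, one_pow]
      · exact pow_le_one₀ (hχ.nonneg _) (hχ.le_one _)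
      · rw [mul_inv, mul_assoc, abs_mul, abs_of_pos (by norm_num : (0 : ℝ) < 2⁻¹)]
        linarith
  have hF2 : F (2 * L) ≤ K2 * c * (|K1| * (C * 8)) := by
    refine (step (2 * L) (by linarith) (by linarith)).trans ?_
    rw [show 2 * (2 * L) = 4 * L by ring]
    calc K2 * (c / (2 * L) * F (4 * L)) ≤ K2 * (c / (2 * L) * (|K1| * (C * (8 * L)))) := by gcongr
      _ = K2 * c * (|K1| * (C * 8)) / 2 := by field_simp
      _ ≤ K2 * c * (|K1| * (C * 8)) := half_le_self (by positivity)
  have hF1 : F L ≤ K2 * c * (K2 * c * (|K1| * (C * 8))) / L := by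
    refine (step L hL (by linarith)).trans ?_
    calc K2 * (c / L * F (2 * L)) ≤ K2 * (c / L * (K2 * c * (|K1| * (C * 8)))) := by gcongr
      _ = K2 * c * (K2 * c * (|K1| * (C * 8))) / L := by ring
  refine le_trans ?_ hF1
  have hsub : shell n L ⊆ shell n (8 * L) := fun x hx => by
    have hx0 : x ≠ 0 := fun h => zero_notMem_shell L (h ▸ hx)
    rw [mem_shell hx0] at hx ⊢
    linarith
  have hle : ∫ x in shell n L, (normPow (-n) * w ^ 2).1 x ≤ J (radCut hχ L m ^ 2 * w ^ 2) := by
    have hmeas := (isCompact_shell (n := n) L).measurableSet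
    have e : ∫ x in shell n L, (normPow (-n) * w ^ 2).1 x =
        ∫ x in shell n L, (normPow (-n) * (radCut hχ L m ^ 2 * w ^ 2)).1 x := by
      refine setIntegral_congr_fun hmeas fun x hx => ?_
      have hx0 : x ≠ 0 := fun h => zero_notMem_shell L (h ▸ hx)
      have e1 := radCut_apply hχ L m hx0
      simp only [MulMemClass.coe_mul, Pi.mul_apply, SubmonoidClass.coe_pow, Pi.pow_apply, e1]
      rw [hχ.eq_one, one_pow, one_pow, one_mul]
      rw [abs_mul, abs_of_pos (inv_pos.2 hL0), inv_mul_le_iff₀ hL0, mul_one]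
      exact (mem_shell hx0).1 hx
    rw [e, hJdef, cylInt_apply]
    refine setIntegral_mono_set
      (integrableOn_of_zero_notMem _ (isCompact_shell _) (zero_notMem_shell _)) ?_
      (LE.le.eventuallyLE hsub)
    refine (ae_restrict_iff' (isCompact_shell (8 * L)).measurableSet).2 (Eventually.of_forall ?_)
    intro x hx
    have hx0 : x ≠ 0 := fun h => zero_notMem_shell _ (h ▸ hx)
    have e1 := normPow_apply (-(n : ℝ)) hx0
    simp only [MulMemClass.coe_mul, Pi.mul_apply, SubmonoidClass.coe_pow, Pi.pow_apply, e1,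
      Pi.zero_apply]
    positivity
  have hterms := hJ.terms_nonneg (E := euler n) (X := rot) (q := radCut hχ L m ^ 2) (w := w)
    (g := g) (fun x _ => sq_nonneg ((radCut hχ L m).1 x)) hwg
  obtain ⟨q1, q2, q3, q4, q5, q6, q7⟩ := hterms
  rw [hF, full, top]
  linarith

lemma eq_zero_of_integral_shell_le {w : smoothOff (EuclideanSpace ℝ (Fin n))} {C : ℝ}
    (h : ∀ L, 1 ≤ L → ∫ x in shell n L, (normPow (-n) * w ^ 2).1 x ≤ C / L)
    {x : EuclideanSpace ℝ (Fin n)} (hx : x ≠ 0) : w.1 x = 0 := by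
  have hpos : ∀ L, ∀ y ∈ shell n L, 0 ≤ (normPow (-n) * w ^ 2).1 y := fun L y hy => by
    have hy0 : y ≠ 0 := fun h => zero_notMem_shell _ (h ▸ hy)
    have e1 := normPow_apply (-(n : ℝ)) hy0
    simp only [MulMemClass.coe_mul, Pi.mul_apply, SubmonoidClass.coe_pow, Pi.pow_apply, e1]
    positivity
  have hint : ∀ L, IntegrableOn (normPow (-n) * w ^ 2).1 (shell n L) := fun L =>
    integrableOn_of_zero_notMem _ (isCompact_shell _) (zero_notMem_shell _)
  obtain ⟨L₀, hL₀⟩ := exists_gt |Real.log ‖x‖|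
  have hL₀0 : 0 < L₀ := (abs_nonneg _).trans_lt hL₀
  have hz : ∫ y in shell n L₀, (normPow (-n) * w ^ 2).1 y = 0 := by
    refine le_antisymm ?_
      (setIntegral_nonneg (isCompact_shell L₀).measurableSet (hpos L₀))
    refine ge_of_tendsto (tendsto_const_nhds.div_atTop tendsto_id : Tendsto (C / ·) atTop (𝓝 0)) ?_
    filter_upwards [eventually_ge_atTop (max 1 L₀)] with L hL
    have hL1 := (le_max_left _ _).trans hL
    have hLL := (le_max_right _ _).trans hL
    refine le_trans ?_ (h L hL1)
    refine setIntegral_mono_set (hint L) ((ae_restrict_iff' (isCompact_shell L).measurableSet).2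
      (Eventually.of_forall (hpos L))) (LE.le.eventuallyLE fun y hy => ?_)
    have hy0 : y ≠ 0 := fun h => zero_notMem_shell _ (h ▸ hy)
    rw [mem_shell hy0] at hy ⊢
    linarith
  rw [setIntegral_eq_zero_iff_of_nonneg_ae ((ae_restrict_iff'
    (isCompact_shell L₀).measurableSet).2 (Eventually.of_forall (hpos L₀))) (hint L₀)] at hz
  set U : Set (EuclideanSpace ℝ (Fin n)) := ball 0 (Real.exp L₀) \ closedBall 0 (Real.exp (-L₀))
    with hU
  have hUo : IsOpen U := isOpen_ball.sdiff isClosed_closedBall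
  have hUs : U ⊆ shell n L₀ := fun y hy =>
    ⟨ball_subset_closedBall hy.1, fun h => hy.2 (ball_subset_closedBall h)⟩
  have heq := Measure.eqOn_open_of_ae_eq (ae_restrict_of_ae_restrict_of_subset hUs hz) hUo
    ((continuousOn_of_zero_notMem _ (zero_notMem_shell L₀)).mono hUs) continuousOn_const
  have hx' := norm_pos_iff.2 hx
  have hxU : x ∈ U := by
    rw [abs_lt] at hL₀
    refine ⟨?_, ?_⟩
    · rw [mem_ball_zero_iff, ← Real.log_lt_iff_lt_exp hx']
      exact hL₀.2
    · rw [mem_closedBall_zero_iff, not_le, ← Real.lt_log_iff_exp_lt hx']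
      exact hL₀.1
  have e1 := normPow_apply (-(n : ℝ)) hx
  have := heq hxU
  rw [MulMemClass.coe_mul, Pi.mul_apply, e1, Pi.zero_apply] at this
  exact pow_eq_zero_iff two_ne_zero |>.1
    ((mul_eq_zero.1 this).resolve_left (Real.rpow_pos_of_pos hx' _).ne')

/-- A smooth stable solution on the whole space vanishes identically. -/
lemma eq_zero_of_stableOn (hn : 5 ≤ n) {a p : ℝ} (ha : 0 ≤ a)
    (hpc : ((n : ℝ) + 4 + 2 * a) / ((n : ℝ) - 4) < p)
    (hl1 : (n : ℝ) * ((n : ℝ) - 4) / 2 < p * ell1 n a p)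
    (hl2 : (n : ℝ) ^ 2 * ((n : ℝ) - 4) ^ 2 / 16 < p * ell2 n a p)
    {u : EuclideanSpace ℝ (Fin n) → ℝ} (hu : ContDiff ℝ (⊤ : ℕ∞) u)
    (hsol : IsSolutionOn n a p u univ) (hstab : StableOn n a p u univ) : u = 0 := by
  have hn' : (5 : ℝ) ≤ n := by exact_mod_cast hn
  have hn4 : (0 : ℝ) < n - 4 := by linarith
  rw [div_lt_iff₀ hn4] at hpc
  have hp : 1 < p := by
    by_contra! h
    nlinarith
  have hp' : 0 < p - 1 := sub_pos.2 hp
  obtain ⟨β, hβ⟩ : ∃ β, β = (4 + a) / (p - 1) := ⟨_, rfl⟩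
  have hβp : β * (p - 1) = 4 + a := by rw [hβ, div_mul_cancel₀ _ hp'.ne']
  obtain ⟨k1, hk1⟩ : ∃ k1, k1 = β * ((n : ℝ) - 2 - β) := ⟨_, rfl⟩
  obtain ⟨k2, hk2⟩ : ∃ k2, k2 = (β + 2) * ((n : ℝ) - 4 - β) := ⟨_, rfl⟩
  have hs : 0 < (n : ℝ) - 4 - 2 * β := by
    by_contra! h
    nlinarith
  have he1 : ell1 n a p = k1 + k2 := by
    rw [ell1, ← hβ, hk1, hk2]
    ring
  have he2 : ell2 n a p = k1 * k2 := by
    rw [ell2, ← hβ, hk1, hk2]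
    ring
  have hk : 0 < k1 + k2 := by
    rw [he1] at hl1
    by_contra! h
    nlinarith
  have hc1 : -k1 * (n - 6 - 2 * β) - k2 * (n - 2 - 2 * β) < 0 := by
    have : -k1 * (n - 6 - 2 * β) - k2 * (n - 2 - 2 * β) =
        -((n - 4 - 2 * β) * (k1 + k2 + 4)) := by
      rw [hk1, hk2]
      ring
    rw [this, neg_lt_zero]
    exact mul_pos hs (by linarith)
  have hgw := fun x hx => cylOp_emden (x := x) hβp hk1 hk2 hu hsol hx
  rw [he1] at hl1
  rw [he2] at hl2
  obtain ⟨C, hC⟩ := exists_integral_shell_le (by omega) hp (by linarith) hc1 hl1 hl2 rfl hgw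
    fun M h hh => stable_emden hβp hu hstab hgw hh
  have : Nonempty (Fin n) := ⟨⟨0, by omega⟩⟩
  refine Continuous.ext_on (dense_compl_singleton 0) hu.continuous continuous_const fun x hx => ?_
  rw [eq_normPow_mul_emden β hu hx, MulMemClass.coe_mul, Pi.mul_apply,
    eq_zero_of_integral_shell_le hC hx, mul_zero, Pi.zero_apply]

lemma energyE_zero {a p : ℝ} (hp : p + 1 ≠ 0) (x : EuclideanSpace ℝ (Fin n)) (r : ℝ) :
    energyE n a p 0 x r = 0 := by
  have h1 : ∀ y, lap n 0 y = 0 := fun y => by simp [lap]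
  have h2 : ∀ y, gradient (0 : EuclideanSpace ℝ (Fin n) → ℝ) y = 0 := fun y => by
    simp [gradient]
  simp [energyE, sphInt, radDeriv, h1, h2, Real.zero_rpow hp]

end Vanishing

end Cyl

/-- Lemma 4.3: for a smooth stable solution in the supercritical
range, `E(r;0,u) → 0` as `r → ∞`. -/
theorem stmt15 (n : ℕ) (hn : 5 ≤ n) (a p : ℝ) (ha : 0 ≤ a)
    (hpc : ((n : ℝ) + 4 + 2 * a) / ((n : ℝ) - 4) < p)
    (hl1 : p * ell1 n a p > (n : ℝ) * ((n : ℝ) - 4) / 2)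
    (hl2 : p * ell2 n a p > (n : ℝ) ^ 2 * ((n : ℝ) - 4) ^ 2 / 16)
    (u : EuclideanSpace ℝ (Fin n) → ℝ) (hu : ContDiff ℝ (⊤ : ℕ∞) u)
    (hsol : IsSolutionOn n a p u Set.univ)
    (hstab : StableOn n a p u Set.univ) :
    Tendsto (fun r : ℝ => energyE n a p u 0 r) atTop (𝓝 0) := by
  have hn' : (5 : ℝ) ≤ n := by exact_mod_cast hn
  have hp : 0 < p := lt_of_le_of_lt (div_nonneg (by linarith) (by linarith)) hpc
  simp only [Cyl.eq_zero_of_stableOn hn ha hpc hl1 hl2 hu hsol hstab,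
    Cyl.energyE_zero (by linarith : p + 1 ≠ 0)]
  exact tendsto_const_nhds
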